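/- arXiv:1604.08399 — 4 statements merged into one kernel-verified Lean document; each statement's English description precedes it below -/
import Mathlib

section
/- Fix L ∈ (0, π). For 0 < α < π − L define x(α) = ∫_L^{L+α} √((cos θ − cos(L+α))/(cos L − cos θ)) dθ. Then x(α) = (π/2)·α + O(α²) as α → 0+; that is, there exist constants δ > 0 and C > 0 such that for all α ∈ (0, δ), |x(α) − (π/2)·α| ≤ C·α². -/
open Real Filter MeasureTheory

lemma hasDerivAt_sqrt_mul_add_arcsin {a b x : ℝ} (hx : x ∈ Set.Ioo a b) :
    HasDerivAt (fun x => √((x - a) * (b - x)) +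
      (b - a) / 2 * arcsin ((2 * x - a - b) / (b - a))) (√((b - x) / (x - a))) x := by
  obtain ⟨hax, hxb⟩ := hx
  have h1 : 0 < x - a := by linarith
  have h2 : 0 < b - x := by linarith
  have h3 : 0 < b - a := by linarith
  have hp : 0 < (x - a) * (b - x) := mul_pos h1 h2
  have hpoly : HasDerivAt (fun x : ℝ => (x - a) * (b - x)) (1 * (b - x) + (x - a) * (-1)) x :=
    ((hasDerivAt_id x).sub_const a).mul ((hasDerivAt_id x).const_sub b)
  have hlin : HasDerivAt (fun x : ℝ => (2 * x - a - b) / (b - a)) (2 * 1 / (b - a)) x :=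
    ((((hasDerivAt_id x).const_mul 2).sub_const a).sub_const b).div_const (b - a)
  have hne1 : (2 * x - a - b) / (b - a) ≠ -1 := by
    intro h
    rw [div_eq_iff h3.ne'] at h
    linarith
  have hne2 : (2 * x - a - b) / (b - a) ≠ 1 := by
    intro h
    rw [div_eq_iff h3.ne'] at h
    linarith
  have harc := (hasDerivAt_arcsin hne1 hne2).comp x hlin
  have hsum := (hpoly.sqrt hp.ne').add (harc.const_mul ((b - a) / 2))
  refine hsum.congr_deriv ?_
  have hsq : 1 - ((2 * x - a - b) / (b - a)) ^ 2 = (x - a) * (b - x) * (2 / (b - a)) ^ 2 := by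
    field_simp
    ring
  have hquot : (b - x) / (x - a) = (x - a) * (b - x) / (x - a) ^ 2 := by
    field_simp
  rw [hsq, hquot, sqrt_mul hp.le, sqrt_sq (by positivity), sqrt_div hp.le, sqrt_sq h1.le]
  have hr : 0 < √((x - a) * (b - x)) := sqrt_pos.2 hp
  have hrr : √((x - a) * (b - x)) ^ 2 = (x - a) * (b - x) := sq_sqrt hp.le
  generalize √((x - a) * (b - x)) = r at hr hrr
  field_simp
  rw [hrr]
  ring

lemma continuous_sqrt_mul_add_arcsin (a b : ℝ) :
    Continuous (fun x => √((x - a) * (b - x)) +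
      (b - a) / 2 * arcsin ((2 * x - a - b) / (b - a))) := by
  have : Continuous fun x : ℝ => arcsin ((2 * x - a - b) / (b - a)) :=
    continuous_arcsin.comp (by fun_prop)
  fun_prop

lemma intervalIntegrable_sqrt_div {a b : ℝ} (hab : a < b) :
    IntervalIntegrable (fun x => √((b - x) / (x - a))) volume a b := by
  refine intervalIntegral.intervalIntegrable_deriv_of_nonneg
    (continuous_sqrt_mul_add_arcsin a b).continuousOn (fun x hx => ?_) (fun x _ => sqrt_nonneg _)
  rw [min_eq_left hab.le, max_eq_right hab.le] at hx
  exact hasDerivAt_sqrt_mul_add_arcsin hx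

lemma integral_sqrt_div {a b : ℝ} (hab : a < b) :
    ∫ x in a..b, √((b - x) / (x - a)) = π / 2 * (b - a) := by
  rw [intervalIntegral.integral_eq_sub_of_hasDerivAt_of_le hab.le
    (continuous_sqrt_mul_add_arcsin a b).continuousOn
    (fun x hx => hasDerivAt_sqrt_mul_add_arcsin hx) (intervalIntegrable_sqrt_div hab)]
  have h3 : b - a ≠ 0 := by linarith
  have e1 : (2 * b - a - b) / (b - a) = 1 := by
    rw [div_eq_iff h3]; ring
  have e2 : (2 * a - a - b) / (b - a) = -1 := by
    rw [div_eq_iff h3]; ring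
  rw [e1, e2, arcsin_one, arcsin_neg_one]
  simp
  ring

lemma abs_sqrt_sub_one_le {x : ℝ} (hx : 0 ≤ x) : |√x - 1| ≤ |x - 1| := by
  have h : x - 1 = (√x - 1) * (√x + 1) := by
    nlinarith [sq_sqrt hx]
  rw [h, abs_mul, abs_of_nonneg (a := √x + 1) (by positivity)]
  nlinarith [abs_nonneg (√x - 1), sqrt_nonneg x]

/-- Mean value theorem for `cos`, with the slope compared to `sin a`. -/
lemma exists_cos_sub_cos_eq {a b u v : ℝ} (hau : a ≤ u) (huv : u < v) (hvb : v ≤ b) :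
    ∃ s, cos u - cos v = (v - u) * s ∧ |s - sin a| ≤ b - a := by
  obtain ⟨c, hc, h⟩ := exists_hasDerivAt_eq_slope cos (fun x => -sin x) huv
    continuous_cos.continuousOn (fun x _ => hasDerivAt_cos x)
  refine ⟨sin c, ?_, ?_⟩
  · rw [eq_div_iff (by linarith)] at h
    linarith
  · refine (abs_sin_sub_sin_le c a).trans ?_
    rw [abs_of_nonneg] <;> linarith [hc.1, hc.2]

lemma abs_sqrt_cos_sub_div_sub_le {a b x : ℝ} (hs : 2 * (b - a) ≤ sin a) (hx : x ∈ Set.Ioc a b) :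
    |√((cos x - cos b) / (cos a - cos x)) - √((b - x) / (x - a))| ≤
      4 * (b - a) / sin a * √((b - x) / (x - a)) := by
  obtain ⟨hax, hxb⟩ := hx
  rcases hxb.eq_or_lt with rfl | hxb
  · simp
  obtain ⟨p, hp, hpa⟩ := exists_cos_sub_cos_eq hax.le hxb le_rfl
  obtain ⟨q, hq, hqa⟩ := exists_cos_sub_cos_eq le_rfl hax hxb.le
  have h3 : 0 < b - a := by linarith
  have hsin : 0 < sin a := by linarith
  rw [abs_le] at hpa hqa
  have hp0 : 0 < p := by linarith
  have hq0 : sin a / 2 ≤ q := by linarith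
  have hq1 : 0 < q := by linarith
  have hxa : 0 < x - a := by linarith
  have hquot : 0 ≤ (b - x) / (x - a) := div_nonneg (by linarith) hxa.le
  have hpq : |p / q - 1| ≤ 4 * (b - a) / sin a := by
    rw [div_sub_one hq1.ne', abs_div, abs_of_pos hq1, div_le_div_iff₀ hq1 hsin]
    have : |p - q| ≤ 2 * (b - a) := by rw [abs_le]; constructor <;> linarith
    nlinarith
  rw [hp, hq, mul_div_mul_comm, sqrt_mul hquot, ← mul_sub_one, abs_mul,
    abs_of_nonneg (sqrt_nonneg _), mul_comm]
  gcongr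
  exact (abs_sqrt_sub_one_le (by positivity)).trans hpq

lemma abs_integral_sqrt_cos_sub_div_sub_le {a b : ℝ} (hab : a < b) (hs : 2 * (b - a) ≤ sin a) :
    |(∫ x in a..b, √((cos x - cos b) / (cos a - cos x))) - π / 2 * (b - a)| ≤
      2 * π / sin a * (b - a) ^ 2 := by
  set g : ℝ → ℝ := fun x => √((b - x) / (x - a))
  set f : ℝ → ℝ := fun x => √((cos x - cos b) / (cos a - cos x))
  have hgi : IntervalIntegrable g volume a b := intervalIntegrable_sqrt_div hab
  have hbound : ∀ᵐ x, x ∈ Set.Ioc a b → ‖f x - g x‖ ≤ 4 * (b - a) / sin a * g x :=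
    Eventually.of_forall fun x hx => abs_sqrt_cos_sub_div_sub_le hs hx
  have hKg := hgi.const_mul (4 * (b - a) / sin a)
  have hfg : IntervalIntegrable (fun x => f x - g x) volume a b := by
    refine hKg.mono_fun' (Measurable.aestronglyMeasurable (by fun_prop)) ?_
    rw [Set.uIoc_of_le hab.le]
    exact (ae_restrict_iff' measurableSet_Ioc).2 hbound
  have hfi : IntervalIntegrable f volume a b := by simpa using hfg.add hgi
  rw [← integral_sqrt_div hab, ← intervalIntegral.integral_sub hfi hgi]
  refine (intervalIntegral.norm_integral_le_of_norm_le hab.le hbound hKg).trans_eq ?_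
  rw [intervalIntegral.integral_const_mul, integral_sqrt_div hab]
  ring

theorem stmt4 (L : ℝ) (hL : L ∈ Set.Ioo 0 π) :
    ∃ δ > (0:ℝ), ∃ C > (0:ℝ), ∀ α ∈ Set.Ioo 0 δ,
      |(∫ θ in L..(L + α),
          Real.sqrt ((Real.cos θ - Real.cos (L + α)) / (Real.cos L - Real.cos θ)))
        - (π / 2) * α| ≤ C * α ^ 2 := by
  have hsin : 0 < sin L := sin_pos_of_mem_Ioo hL
  refine ⟨sin L / 2, by positivity, 2 * π / sin L, by positivity, fun α hα => ?_⟩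
  have h := abs_integral_sqrt_cos_sub_div_sub_le (a := L) (b := L + α)
    (by linarith [hα.1]) (by linarith [hα.2])
  rwa [add_sub_cancel_left] at h
end

section
/- Fix L ∈ (0, π). For 0 < α < π − L define N(α) = ∫_{L+α}^{2π−L−α} dθ / (√(cos L − cos θ) · √(cos(L+α) − cos θ)) and D(α) = ∫_L^{L+α} dθ / (√(cos L − cos θ) · √(cos θ − cos(L+α))). Then N(α)/D(α) = −(2/π)·log α + O(1) as α → 0+; that is, there exist constants δ > 0 and C > 0 such that for all α ∈ (0, δ), |N(α)/D(α) + (2/π)·log α| ≤ C. -/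
open Real Filter MeasureTheory

/-- Fundamental theorem of calculus for a nonnegative derivative, with integrability as part of the
conclusion. -/
theorem intervalIntegrable_and_integral_eq_sub_of_deriv_nonneg {F f : ℝ → ℝ} {a b : ℝ}
    (hab : a ≤ b) (hcont : ContinuousOn F (Set.Icc a b))
    (hderiv : ∀ x ∈ Set.Ioo a b, HasDerivAt F (f x) x) (hpos : ∀ x ∈ Set.Ioo a b, 0 ≤ f x) :
    IntervalIntegrable f volume a b ∧ ∫ x in a..b, f x = F b - F a := by
  have hinteg : IntervalIntegrable f volume a b := by
    apply intervalIntegral.intervalIntegrable_deriv_of_nonneg (g := F)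
    · rwa [Set.uIcc_of_le hab]
    · rwa [min_eq_left hab, max_eq_right hab]
    · rwa [min_eq_left hab, max_eq_right hab]
  exact ⟨hinteg, intervalIntegral.integral_eq_sub_of_hasDerivAt_of_le hab hcont hderiv hinteg⟩

/-- If the weighted function `w * f` is integrable and `(s - w) * f` is dominated by an integrable
function `g`, then `f` is integrable and `s * ∫ f` differs from `∫ w * f` by at most `∫ g`. -/
theorem intervalIntegrable_and_abs_mul_integral_sub_le {f w g : ℝ → ℝ} {a b s : ℝ} (hab : a ≤ b)
    (hs : s ≠ 0) (hf : Measurable f) (hw : Measurable w)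
    (hwf : IntervalIntegrable (fun x => w x * f x) volume a b)
    (hg : IntervalIntegrable g volume a b)
    (hle : ∀ x ∈ Set.Ioo a b, |(s - w x) * f x| ≤ g x) :
    IntervalIntegrable f volume a b ∧
      |s * (∫ x in a..b, f x) - ∫ x in a..b, w x * f x| ≤ ∫ x in a..b, g x := by
  have hae : ∀ᵐ x ∂volume, x ∈ Set.Ioc a b → ‖(s - w x) * f x‖ ≤ g x := by
    have hb : ∀ᵐ x ∂(volume : Measure ℝ), x ≠ b := by
      simp [ae_iff]
    filter_upwards [hb] with x hxb hx
    exact hle x ⟨hx.1, lt_of_le_of_ne hx.2 hxb⟩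
  have hdiff : IntervalIntegrable (fun x => (s - w x) * f x) volume a b := by
    refine hg.mono_fun' ((hw.const_sub s).mul hf).aestronglyMeasurable ?_
    rw [Set.uIoc_of_le hab]
    exact (ae_restrict_iff' measurableSet_Ioc).2 hae
  have hfint : IntervalIntegrable f volume a b := by
    have h := (hdiff.add hwf).const_mul s⁻¹
    refine h.congr fun x _ => ?_
    field_simp
    ring
  refine ⟨hfint, ?_⟩
  have heq : s * (∫ x in a..b, f x) - ∫ x in a..b, w x * f x
      = ∫ x in a..b, (s - w x) * f x := by
    rw [← intervalIntegral.integral_const_mul,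
      ← intervalIntegral.integral_sub (hfint.const_mul s) hwf]
    simp only [sub_mul]
  rw [heq]
  exact intervalIntegral.norm_integral_le_of_norm_le hab hae hg

theorem two_mul_div_pi_mul_sub_le_cos_sub_cos {σ x y : ℝ} (hσ : 0 ≤ σ) (hxy : x ≤ y)
    (hyx : y - x ≤ π) (hsin : σ ≤ sin ((x + y) / 2)) :
    2 * σ / π * (y - x) ≤ cos x - cos y := by
  have h1 : 2 / π * ((y - x) / 2) ≤ sin ((y - x) / 2) :=
    mul_le_sin (by linarith) (by linarith)
  have h2 : cos x - cos y = 2 * (sin ((x + y) / 2) * sin ((y - x) / 2)) := by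
    rw [cos_sub_cos, show (x - y) / 2 = -((y - x) / 2) by ring, sin_neg]
    ring
  have h0 : 0 ≤ 2 / π * ((y - x) / 2) := by
    have : 0 ≤ y - x := by linarith
    positivity
  calc 2 * σ / π * (y - x) = 2 * (σ * (2 / π * ((y - x) / 2))) := by ring
    _ ≤ 2 * (sin ((x + y) / 2) * sin ((y - x) / 2)) := by gcongr; exact hσ.trans hsin
    _ = cos x - cos y := h2.symm

/-- The integral `∫ dt / √((cos L - t) (t - cos M)) = π` after the substitution `t = cos θ`. -/
theorem integral_sin_mul_inv_sqrt_between {L M : ℝ} (hL : 0 ≤ L) (hLM : L < M) (hM : M ≤ π) :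
    IntervalIntegrable (fun θ => sin θ * (1 / (√(cos L - cos θ) * √(cos θ - cos M)))) volume L M ∧
      ∫ θ in L..M, sin θ * (1 / (√(cos L - cos θ) * √(cos θ - cos M))) = π := by
  have hab : cos M < cos L := cos_lt_cos_of_nonneg_of_le_pi hL hM hLM
  have hd : cos L - cos M ≠ 0 := by linarith
  have key := intervalIntegrable_and_integral_eq_sub_of_deriv_nonneg
    (F := fun θ => arcsin ((cos L + cos M - 2 * cos θ) / (cos L - cos M)))
    (f := fun θ => sin θ * (1 / (√(cos L - cos θ) * √(cos θ - cos M)))) hLM.le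
    (by fun_prop) ?_ ?_
  · obtain ⟨h1, h2⟩ := key
    refine ⟨h1, h2.trans ?_⟩
    have e1 : (cos L + cos M - 2 * cos M) / (cos L - cos M) = 1 := by
      rw [div_eq_one_iff_eq hd]; ring
    have e2 : (cos L + cos M - 2 * cos L) / (cos L - cos M) = -1 := by
      rw [div_eq_iff hd]; ring
    rw [e1, e2, arcsin_neg, arcsin_one]
    ring
  · intro θ hθ
    have hp : 0 < cos L - cos θ :=
      sub_pos.2 (cos_lt_cos_of_nonneg_of_le_pi hL (hθ.2.le.trans hM) hθ.1)
    have hq : 0 < cos θ - cos M :=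
      sub_pos.2 (cos_lt_cos_of_nonneg_of_le_pi (hL.trans hθ.1.le) hM hθ.2)
    have hD : 0 < cos L - cos M := by linarith
    have hinner : HasDerivAt (fun θ => (cos L + cos M - 2 * cos θ) / (cos L - cos M))
        ((2 * sin θ) / (cos L - cos M)) θ := by
      have := (((hasDerivAt_cos θ).const_mul 2).const_sub (cos L + cos M)).div_const
        (cos L - cos M)
      exact this.congr_deriv (by ring)
    have hne1 : (cos L + cos M - 2 * cos θ) / (cos L - cos M) ≠ -1 := by
      rw [Ne, div_eq_iff hd]; intro h; linarith
    have hne2 : (cos L + cos M - 2 * cos θ) / (cos L - cos M) ≠ 1 := by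
      rw [Ne, div_eq_iff hd]; intro h; linarith
    have h := (hasDerivAt_arcsin hne1 hne2).comp θ hinner
    refine h.congr_deriv ?_
    have hsq : 1 - ((cos L + cos M - 2 * cos θ) / (cos L - cos M)) ^ 2
        = (2 * (√(cos L - cos θ) * √(cos θ - cos M)) / (cos L - cos M)) ^ 2 := by
      rw [div_pow, div_pow, mul_pow, mul_pow, sq_sqrt hp.le, sq_sqrt hq.le]
      field_simp
      ring
    rw [hsq, sqrt_sq (by positivity)]
    have := sqrt_pos.2 hp
    have := sqrt_pos.2 hq
    field_simp
  · intro θ hθ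
    have := sin_nonneg_of_nonneg_of_le_pi (hL.trans hθ.1.le) (hθ.2.le.trans hM)
    positivity

/-- The integral `∫ dt / √((cos L - t) (cos M - t))` over `(-1, cos M)`, after the substitution
`t = cos θ`. -/
theorem integral_sin_mul_inv_sqrt_above {L M : ℝ} (hL : 0 ≤ L) (hLM : L < M) (hM : M ≤ π) :
    IntervalIntegrable (fun θ => sin θ * (1 / (√(cos L - cos θ) * √(cos M - cos θ)))) volume M π ∧
      ∫ θ in M..π, sin θ * (1 / (√(cos L - cos θ) * √(cos M - cos θ)))
        = 2 * log (√(cos L + 1) + √(cos M + 1)) - log (cos L - cos M) := by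
  have hpos : ∀ θ ∈ Set.Icc M π, 0 < cos L - cos θ := fun θ hθ =>
    sub_pos.2 (cos_lt_cos_of_nonneg_of_le_pi hL hθ.2 (hLM.trans_le hθ.1))
  have key := intervalIntegrable_and_integral_eq_sub_of_deriv_nonneg
    (F := fun θ => 2 * log (√(cos L - cos θ) + √(cos M - cos θ)))
    (f := fun θ => sin θ * (1 / (√(cos L - cos θ) * √(cos M - cos θ)))) hM ?_ ?_ ?_
  · obtain ⟨h1, h2⟩ := key
    refine ⟨h1, h2.trans ?_⟩
    simp only [cos_pi, sub_neg_eq_add, sub_self, sqrt_zero, add_zero]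
    rw [log_sqrt (hpos M ⟨le_rfl, hM⟩).le]
    ring
  · refine continuousOn_const.mul (ContinuousOn.log (by fun_prop) fun θ hθ => ?_)
    have := sqrt_pos.2 (hpos θ hθ)
    positivity
  · intro θ hθ
    have hp : 0 < cos L - cos θ := hpos θ ⟨hθ.1.le, hθ.2.le⟩
    have hq : 0 < cos M - cos θ :=
      sub_pos.2 (cos_lt_cos_of_nonneg_of_le_pi (hL.trans hLM.le) hθ.2.le hθ.1)
    have sp := sqrt_pos.2 hp
    have sq := sqrt_pos.2 hq
    have d1 := ((hasDerivAt_cos θ).const_sub (cos L)).sqrt hp.ne'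
    have d2 := ((hasDerivAt_cos θ).const_sub (cos M)).sqrt hq.ne'
    have h := ((d1.add d2).log (by simp only [Pi.add_apply]; positivity)).const_mul 2
    refine h.congr_deriv ?_
    simp only [Pi.add_apply]
    field_simp
    ring
  · intro θ hθ
    have := sin_nonneg_of_nonneg_of_le_pi ((hL.trans hLM.le).trans hθ.1.le) hθ.2.le
    positivity

theorem integral_inv_sqrt_sub {a b : ℝ} (hab : a ≤ b) :
    IntervalIntegrable (fun x => 1 / √(x - a)) volume a b ∧
      ∫ x in a..b, 1 / √(x - a) = 2 * √(b - a) := by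
  have key := intervalIntegrable_and_integral_eq_sub_of_deriv_nonneg
    (F := fun x => 2 * √(x - a)) (f := fun x => 1 / √(x - a)) hab
    (by fun_prop) ?_ (fun x _ => by positivity)
  · obtain ⟨h1, h2⟩ := key
    exact ⟨h1, h2.trans (by simp)⟩
  · intro x hx
    have hp : 0 < x - a := sub_pos.2 hx.1
    have h := (((hasDerivAt_id x).sub_const a).sqrt hp.ne').const_mul 2
    refine h.congr_deriv ?_
    simp only [id]
    field_simp

/-- The integral between the two branch points is `π / sin L` up to `O(M - L)`. -/
theorem integral_between_estimate {L M σ : ℝ} (hL : 0 < L) (hLM : L < M) (hM : M < π)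
    (hσ : 0 < σ) (hsin : ∀ θ ∈ Set.Icc L M, σ ≤ sin θ) :
    π ≤ ∫ θ in L..M, 1 / (√(cos L - cos θ) * √(cos θ - cos M)) ∧
      |sin L * (∫ θ in L..M, 1 / (√(cos L - cos θ) * √(cos θ - cos M))) - π|
        ≤ (M - L) * (π / σ) := by
  obtain ⟨hinteg, hval⟩ := integral_sin_mul_inv_sqrt_between hL.le hLM hM.le
  have hsL : sin L ≠ 0 := (sin_pos_of_pos_of_lt_pi hL (hLM.trans hM)).ne'
  have key := intervalIntegrable_and_abs_mul_integral_sub_le hLM.le hsL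
    (f := fun θ => 1 / (√(cos L - cos θ) * √(cos θ - cos M))) (w := sin)
    (by fun_prop) (by fun_prop) hinteg (hinteg.const_mul ((M - L) / σ)) ?_
  · obtain ⟨h1, h2⟩ := key
    rw [intervalIntegral.integral_const_mul, hval] at h2
    constructor
    · rw [← hval]
      refine intervalIntegral.integral_mono_on hLM.le hinteg h1 fun θ _ => ?_
      exact mul_le_of_le_one_left (by positivity) (sin_le_one θ)
    · exact h2.trans_eq (by ring)
  · intro θ hθ
    have hs := hsin θ ⟨hθ.1.le, hθ.2.le⟩
    have hf : 0 ≤ 1 / (√(cos L - cos θ) * √(cos θ - cos M)) := by positivity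
    rw [abs_mul, abs_of_nonneg hf, ← mul_assoc]
    refine mul_le_mul_of_nonneg_right ?_ hf
    have hle : |sin L - sin θ| ≤ M - L := by
      refine (abs_sin_sub_sin_le L θ).trans ?_
      rw [abs_sub_comm, abs_of_pos (sub_pos.2 hθ.1)]
      linarith [hθ.2]
    refine hle.trans ?_
    rw [div_mul_eq_mul_div, le_div_iff₀ hσ]
    exact mul_le_mul_of_nonneg_left hs (by linarith)

/-- The integral beyond both branch points differs from its explicit model by a bounded amount. -/
theorem integral_above_estimate {L M σ : ℝ} (hL : 0 < L) (hLM : L < M) (hM : M < π)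
    (hσ : 0 < σ) (hsin : ∀ θ ∈ Set.Icc L ((M + π) / 2), σ ≤ sin θ) :
    IntervalIntegrable (fun θ => 1 / (√(cos L - cos θ) * √(cos M - cos θ))) volume M π ∧
      |sin L * (∫ θ in M..π, 1 / (√(cos L - cos θ) * √(cos M - cos θ)))
        - (2 * log (√(cos L + 1) + √(cos M + 1)) - log (cos L - cos M))| ≤ π ^ 2 / σ := by
  obtain ⟨hinteg, hval⟩ := integral_sin_mul_inv_sqrt_above hL.le hLM hM.le
  have hsL : sin L ≠ 0 := (sin_pos_of_pos_of_lt_pi hL (hLM.trans hM)).ne'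
  obtain ⟨gint, gval⟩ := integral_inv_sqrt_sub hM.le
  have hc : 0 < 2 * σ / π := by positivity
  have key := intervalIntegrable_and_abs_mul_integral_sub_le hM.le hsL
    (f := fun θ => 1 / (√(cos L - cos θ) * √(cos M - cos θ))) (w := sin)
    (by fun_prop) (by fun_prop) hinteg (gint.const_mul (√π / (2 * σ / π))) ?_
  · obtain ⟨h1, h2⟩ := key
    rw [intervalIntegral.integral_const_mul, gval, hval] at h2
    refine ⟨h1, h2.trans ?_⟩
    calc √π / (2 * σ / π) * (2 * √(π - M)) ≤ √π / (2 * σ / π) * (2 * √π) := by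
          gcongr
          linarith
      _ = (√π * √π) * π / σ := by field_simp
      _ = π ^ 2 / σ := by rw [mul_self_sqrt pi_pos.le]; ring
  · intro θ hθ
    have uL : 0 < θ - L := by linarith [hθ.1]
    have uM : 0 < θ - M := by linarith [hθ.1]
    have b1 : 2 * σ / π * (θ - L) ≤ cos L - cos θ :=
      two_mul_div_pi_mul_sub_le_cos_sub_cos hσ.le (by linarith) (by linarith [hθ.2])
        (hsin _ ⟨by linarith, by linarith [hθ.2]⟩)
    have b2 : 2 * σ / π * (θ - M) ≤ cos M - cos θ :=
      two_mul_div_pi_mul_sub_le_cos_sub_cos hσ.le (by linarith) (by linarith [hθ.2])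
        (hsin _ ⟨by linarith [hθ.1], by linarith [hθ.2]⟩)
    have hf : 0 ≤ 1 / (√(cos L - cos θ) * √(cos M - cos θ)) := by positivity
    have hs : |sin L - sin θ| ≤ θ - L := by
      refine (abs_sin_sub_sin_le L θ).trans ?_
      rw [abs_sub_comm, abs_of_pos uL]
    have sL := sqrt_pos.2 uL
    have sM := sqrt_pos.2 uM
    have sc := sqrt_pos.2 hc
    have hcc := mul_self_sqrt hc.le
    have hLL := mul_self_sqrt uL.le
    rw [abs_mul, abs_of_nonneg hf]
    generalize 2 * σ / π = c at *
    calc |sin L - sin θ| * (1 / (√(cos L - cos θ) * √(cos M - cos θ)))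
        ≤ (θ - L) * (1 / (√(c * (θ - L)) * √(c * (θ - M)))) := by
          gcongr
      _ = (√(θ - L) * √(θ - L)) * (1 / ((√c * √c) * (√(θ - L) * √(θ - M)))) := by
          rw [sqrt_mul hc.le, sqrt_mul hc.le, hLL]
          ring
      _ = √(θ - L) / (√c * √c) * (1 / √(θ - M)) := by field_simp
      _ = √(θ - L) / c * (1 / √(θ - M)) := by rw [hcc]
      _ ≤ √π / c * (1 / √(θ - M)) := by
          gcongr
          linarith [hθ.2]

theorem integral_symm_about_pi {f : ℝ → ℝ} {M : ℝ} (hf : ∀ x, f (2 * π - x) = f x)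
    (hinteg : IntervalIntegrable f volume M π) :
    ∫ x in M..(2 * π - M), f x = 2 * ∫ x in M..π, f x := by
  have hinteg' : IntervalIntegrable f volume π (2 * π - M) := by
    have h := (hinteg.comp_sub_left (2 * π)).symm
    simp only [hf] at h
    rwa [show 2 * π - π = π by ring] at h
  have heq : ∫ x in M..π, f x = ∫ x in π..(2 * π - M), f x := by
    have h := intervalIntegral.integral_comp_sub_left (a := M) (b := π) f (2 * π)
    simp only [hf] at h
    rwa [show 2 * π - π = π by ring] at h
  rw [← intervalIntegral.integral_add_adjacent_intervals hinteg hinteg', ← heq]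
  ring

theorem exists_sin_lower_bound {L B : ℝ} (hL : 0 < L) (hB : B < π) :
    ∃ σ > 0, ∀ θ ∈ Set.Icc L B, σ ≤ sin θ := by
  have hpos : ∀ θ ∈ Set.Icc L B, 0 < sin θ := fun θ hθ =>
    sin_pos_of_pos_of_lt_pi (hL.trans_le hθ.1) (hθ.2.trans_lt hB)
  exact isCompact_Icc.exists_forall_le' continuous_sin.continuousOn hpos

theorem stmt5 (L : ℝ) (hL : L ∈ Set.Ioo 0 π) :
    ∃ δ > (0:ℝ), ∃ C > (0:ℝ), ∀ α ∈ Set.Ioo 0 δ,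
      |(∫ θ in (L + α)..(2 * π - L - α),
          1 / (Real.sqrt (Real.cos L - Real.cos θ) * Real.sqrt (Real.cos (L + α) - Real.cos θ))) /
        (∫ θ in L..(L + α),
          1 / (Real.sqrt (Real.cos L - Real.cos θ) * Real.sqrt (Real.cos θ - Real.cos (L + α)))) +
        (2 / π) * Real.log α| ≤ C := by
  obtain ⟨hL0, hLπ⟩ := hL
  obtain ⟨δ, hδ0, hδ1, hδL⟩ : ∃ δ > 0, δ ≤ 1 ∧ L + δ < π :=
    ⟨min 1 ((π - L) / 2), lt_min one_pos (by linarith), min_le_left _ _, by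
      linarith [min_le_right 1 ((π - L) / 2)]⟩
  obtain ⟨σ, hσ, hsin⟩ := exists_sin_lower_bound (B := (L + δ + π) / 2) hL0 (by linarith)
  have hsL : 0 < sin L := sin_pos_of_pos_of_lt_pi hL0 hLπ
  have hcL : 0 < cos L + 1 := by
    have := cos_lt_cos_of_nonneg_of_le_pi hL0.le le_rfl hLπ
    rw [cos_pi] at this
    linarith
  obtain ⟨K, hK⟩ : ∃ K, K = |log (2 * σ / π)| + 2 * |log √(cos L + 1)| + 2 * log 4 := ⟨_, rfl⟩
  have hlog4 : 0 < log 4 := log_pos (by norm_num)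
  have hK0 : 0 < K := by rw [hK]; positivity
  refine ⟨δ, hδ0, (2 * (π ^ 2 / σ + K) + 2 / σ) / (sin L * π), by positivity, ?_⟩
  rintro α ⟨hα0, hαδ⟩
  have hLM : L < L + α := by linarith
  have hM : L + α < π := by linarith
  obtain ⟨hDπ, hD⟩ := integral_between_estimate hL0 hLM hM hσ
    fun θ hθ => hsin θ ⟨hθ.1, by linarith [hθ.2]⟩
  obtain ⟨hNint, hN⟩ := integral_above_estimate hL0 hLM hM hσ
    fun θ hθ => hsin θ ⟨hθ.1, by linarith [hθ.2]⟩
  rw [show 2 * π - L - α = 2 * π - (L + α) by ring,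
    integral_symm_about_pi (fun x => by rw [cos_two_pi_sub]) hNint]
  have hmodel : |2 * log (√(cos L + 1) + √(cos (L + α) + 1)) - log (cos L - cos (L + α))
      + log α| ≤ K := by
    have hlo : 2 * σ / π * α ≤ cos L - cos (L + α) := by
      have := two_mul_div_pi_mul_sub_le_cos_sub_cos hσ.le hLM.le (by linarith)
        (hsin ((L + (L + α)) / 2) ⟨by linarith, by linarith⟩)
      rwa [add_sub_cancel_left] at this
    have hhi : cos L - cos (L + α) ≤ α := by
      have := (le_abs_self _).trans (abs_cos_sub_cos_le L (L + α))
      rwa [show L - (L + α) = -α by ring, abs_neg, abs_of_pos hα0] at this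
    have hc : 0 < 2 * σ / π := by positivity
    have l1 : log (2 * σ / π) + log α ≤ log (cos L - cos (L + α)) := by
      rw [← log_mul hc.ne' hα0.ne']
      exact log_le_log (by positivity) hlo
    have l2 : log (cos L - cos (L + α)) ≤ log α :=
      log_le_log ((mul_pos hc hα0).trans_le hlo) hhi
    have hs := sqrt_pos.2 hcL
    have l3 : log √(cos L + 1) ≤ log (√(cos L + 1) + √(cos (L + α) + 1)) :=
      log_le_log hs (le_add_of_nonneg_right (sqrt_nonneg _))
    have hsq : ∀ x, √(cos x + 1) ≤ 2 := fun x => by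
      rw [sqrt_le_left (by norm_num)]
      linarith [cos_le_one x]
    have l4 : log (√(cos L + 1) + √(cos (L + α) + 1)) ≤ log 4 :=
      log_le_log (by positivity) (by linarith [hsq L, hsq (L + α)])
    have a1 := neg_abs_le (log (2 * σ / π))
    have a2 := neg_abs_le (log √(cos L + 1))
    have a3 := abs_nonneg (log (2 * σ / π))
    have a4 := abs_nonneg (log √(cos L + 1))
    rw [abs_le]
    constructor <;> linarith
  have hαlog : |log α * α| ≤ 1 := (abs_log_mul_self_lt α hα0 (by linarith)).le
  rw [add_sub_cancel_left] at hD
  generalize (∫ θ in L..(L + α), 1 / (√(cos L - cos θ) * √(cos θ - cos (L + α)))) = D at *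
  generalize (∫ θ in (L + α)..π, 1 / (√(cos L - cos θ) * √(cos (L + α) - cos θ))) = I at *
  generalize 2 * log (√(cos L + 1) + √(cos (L + α) + 1)) - log (cos L - cos (L + α)) = H at *
  have hD0 : 0 < D := pi_pos.trans_le hDπ
  have hnum : 2 * I / D + 2 / π * log α
      = (2 * ((sin L * I - H) + (H + log α)) + 2 / π * (log α * (sin L * D - π))) / (sin L * D) := by
    field_simp
    ring
  have herr : |log α * (sin L * D - π)| ≤ π / σ := by
    rw [abs_mul]
    calc |log α| * |sin L * D - π| ≤ |log α| * (α * (π / σ)) := by gcongr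
      _ = |log α * α| * (π / σ) := by rw [abs_mul, abs_of_pos hα0]; ring
      _ ≤ 1 * (π / σ) := by gcongr
      _ = π / σ := one_mul _
  rw [hnum, abs_div, abs_of_pos (mul_pos hsL hD0)]
  have htop : |2 * ((sin L * I - H) + (H + log α)) + 2 / π * (log α * (sin L * D - π))|
      ≤ 2 * (π ^ 2 / σ + K) + 2 / σ := by
    calc _ ≤ |2 * ((sin L * I - H) + (H + log α))| + |2 / π * (log α * (sin L * D - π))| :=
          abs_add_le _ _
      _ = 2 * |(sin L * I - H) + (H + log α)| + 2 / π * |log α * (sin L * D - π)| := by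
          rw [abs_mul, abs_mul, abs_of_pos (by positivity : (0:ℝ) < 2 / π), abs_two]
      _ ≤ 2 * (π ^ 2 / σ + K) + 2 / π * (π / σ) := by
          gcongr
          exact (abs_add_le _ _).trans (add_le_add hN hmodel)
      _ = 2 * (π ^ 2 / σ + K) + 2 / σ := by field_simp
  gcongr
end

section
/- Fix L ∈ (0, π), set x_c = −2·log(tan(L/4)), and fix x ∈ (0, x_c). Then lim_{n→∞} (1/n) · [ s² · (∂²/∂s²) log D_n(s, L) + s · (∂/∂s) log D_n(s, L) ] evaluated at s = e^{−xn} equals 0. (This quantity is the conditional variance of the number of eigenvalues outside the arc given that no thinned eigenvalue lies outside it.) -/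
open Real Filter MeasureTheory

/-- Fourier coefficients of the symbol: `f₀ = L/π + s(π-L)/π`, `f_m = (1-s) sin(mL)/(πm)`. -/
noncomputable def toeplitzCoeff (L s : ℝ) (m : ℤ) : ℝ :=
  if m = 0 then L / π + s * (π - L) / π
  else (1 - s) * Real.sin ((m : ℝ) * L) / (π * (m : ℝ))

/-- The Toeplitz determinant `D_n(s,L) = det(f_{k-j})_{j,k=1,…,n}`. -/
noncomputable def toeplitzDet (n : ℕ) (s L : ℝ) : ℝ :=
  Matrix.det (Matrix.of fun j k : Fin n =>
    toeplitzCoeff L s (((k : ℕ) : ℤ) - ((j : ℕ) : ℤ)))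

open Polynomial in
/-- The squared modulus of a real polynomial at the point `e^{iθ}` of the unit circle. -/
noncomputable def circleNormSq (p : ℝ[X]) (θ : ℝ) : ℝ :=
  Complex.normSq (aeval (Complex.exp (θ * Complex.I)) p)

/-- The Toeplitz matrix of the indicator of the arc `|θ| < L`. -/
noncomputable def arcMatrix (n : ℕ) (L : ℝ) : Matrix (Fin n) (Fin n) ℝ :=
  Matrix.of fun j k => toeplitzCoeff L 0 (((k : ℕ) : ℤ) - ((j : ℕ) : ℤ))

section CircleNormSq

open Polynomial

lemma circleNormSq_nonneg (p : ℝ[X]) (θ : ℝ) : 0 ≤ circleNormSq p θ :=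
  Complex.normSq_nonneg _

lemma continuous_circleNormSq (p : ℝ[X]) : Continuous (circleNormSq p) := by
  unfold circleNormSq
  exact Complex.continuous_normSq.comp
    ((Polynomial.continuous_aeval p).comp (by fun_prop))

lemma intervalIntegrable_circleNormSq (p : ℝ[X]) (a b : ℝ) :
    IntervalIntegrable (circleNormSq p) volume a b :=
  (continuous_circleNormSq p).intervalIntegrable a b

lemma circleNormSq_mul_X_sub_one_pow (p : ℝ[X]) (d : ℕ) (θ : ℝ) :
    circleNormSq (p * (X - 1) ^ d) θ = circleNormSq p θ * (2 * (1 - Real.cos θ)) ^ d := by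
  have h : Complex.normSq (Complex.exp (θ * Complex.I) - 1) = 2 * (1 - Real.cos θ) := by
    rw [Complex.exp_mul_I, ← Complex.ofReal_cos, ← Complex.ofReal_sin, Complex.normSq_apply]
    simp only [Complex.sub_re, Complex.sub_im, Complex.add_re, Complex.add_im, Complex.ofReal_re,
      Complex.ofReal_im, Complex.mul_re, Complex.mul_im, Complex.I_re, Complex.I_im,
      Complex.one_re, Complex.one_im]
    nlinarith [Real.sin_sq_add_cos_sq θ]
  simp [circleNormSq, h]

lemma circleNormSq_eq_sum {n : ℕ} {p : ℝ[X]} (hp : p.natDegree < n) (θ : ℝ) :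
    circleNormSq p θ = ∑ j : Fin n, ∑ k : Fin n,
      p.coeff j * p.coeff k * Real.cos (((((k : ℕ) : ℤ) - ((j : ℕ) : ℤ) : ℤ) : ℝ) * θ) := by
  have h : aeval (Complex.exp (θ * Complex.I)) p = ∑ j : Fin n,
      (((p.coeff j * Real.cos (j * θ) : ℝ) : ℂ) +
        ((p.coeff j * Real.sin (j * θ) : ℝ) : ℂ) * Complex.I) := by
    rw [aeval_eq_sum_range' hp, ← Fin.sum_univ_eq_sum_range
      (fun i => p.coeff i • Complex.exp (θ * Complex.I) ^ i) n]
    refine Finset.sum_congr rfl fun j _ => ?_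
    rw [← Complex.exp_nat_mul, ← mul_assoc, Complex.exp_mul_I, Complex.real_smul]
    push_cast
    ring
  rw [circleNormSq, h, Complex.normSq_apply]
  simp only [Complex.re_sum, Complex.im_sum, Complex.add_re, Complex.add_im, Complex.ofReal_re,
    Complex.ofReal_im, Complex.mul_re, Complex.mul_im, Complex.I_re, Complex.I_im, mul_zero,
    mul_one, add_zero, zero_add, sub_self]
  rw [Finset.sum_mul_sum, Finset.sum_mul_sum, ← Finset.sum_add_distrib]
  refine Finset.sum_congr rfl fun j _ => ?_
  rw [← Finset.sum_add_distrib]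
  refine Finset.sum_congr rfl fun k _ => ?_
  push_cast
  rw [sub_mul, Real.cos_sub]
  ring

lemma integral_cos_int_mul (L : ℝ) (m : ℤ) :
    ∫ θ in (0 : ℝ)..L, Real.cos ((m : ℝ) * θ) = π * toeplitzCoeff L 0 m := by
  unfold toeplitzCoeff
  split_ifs with hm
  · subst hm
    simp
    field_simp
  · have hm' : (m : ℝ) ≠ 0 := by exact_mod_cast hm
    rw [intervalIntegral.integral_comp_mul_left _ hm', integral_cos]
    simp
    field_simp

lemma integral_circleNormSq {n : ℕ} {p : ℝ[X]} (hp : p.natDegree < n) (L : ℝ) :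
    ∫ θ in (0 : ℝ)..L, circleNormSq p θ =
      π * ((fun i : Fin n => p.coeff i) ⬝ᵥ
        (arcMatrix n L).mulVec (fun i : Fin n => p.coeff i)) := by
  simp_rw [circleNormSq_eq_sum hp]
  have hint : ∀ c : ℝ, ∀ m : ℤ, IntervalIntegrable
      (fun θ : ℝ => c * Real.cos ((m : ℝ) * θ)) volume 0 L := fun c m =>
    Continuous.intervalIntegrable (by fun_prop) _ _
  rw [intervalIntegral.integral_finsetSum fun j _ =>
    Continuous.intervalIntegrable (by fun_prop) _ _]
  simp only [dotProduct, Matrix.mulVec, Finset.mul_sum]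
  refine Finset.sum_congr rfl fun j _ => ?_
  rw [intervalIntegral.integral_finsetSum fun k _ => hint _ _]
  refine Finset.sum_congr rfl fun k _ => ?_
  rw [intervalIntegral.integral_const_mul, integral_cos_int_mul]
  simp only [arcMatrix, Matrix.of_apply]
  ring

lemma arcMatrix_pi (n : ℕ) : arcMatrix n π = 1 := by
  ext j k
  rw [arcMatrix, Matrix.of_apply, toeplitzCoeff, Matrix.one_apply]
  have : ((k : ℕ) : ℤ) - ((j : ℕ) : ℤ) = 0 ↔ j = k := by rw [Fin.ext_iff]; omega
  simp only [this, Real.sin_int_mul_pi]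
  split_ifs <;> simp [Real.pi_ne_zero]

lemma integral_circleNormSq_pi {n : ℕ} {p : ℝ[X]} (hp : p.natDegree < n) :
    ∫ θ in (0 : ℝ)..π, circleNormSq p θ =
      π * ((fun i : Fin n => p.coeff i) ⬝ᵥ (fun i : Fin n => p.coeff i)) := by
  rw [integral_circleNormSq hp, arcMatrix_pi, Matrix.one_mulVec]

lemma exists_eval_cos_eq_circleNormSq {n : ℕ} {p : ℝ[X]} (hp : p.natDegree < n) :
    ∃ Q : ℝ[X], Q.natDegree < n ∧ ∀ θ, Q.eval (Real.cos θ) = circleNormSq p θ := by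
  refine ⟨∑ j : Fin n, ∑ k : Fin n, C (p.coeff j * p.coeff k) *
    Chebyshev.T ℝ (((k : ℕ) : ℤ) - ((j : ℕ) : ℤ)), ?_, fun θ => ?_⟩
  · refine Nat.lt_of_le_pred (by omega) ?_
    refine natDegree_sum_le_of_forall_le _ _ fun j _ =>
      natDegree_sum_le_of_forall_le _ _ fun k _ => ?_
    refine (natDegree_C_mul_le _ _).trans ?_
    rw [Chebyshev.natDegree_T]
    have := j.2
    have := k.2
    simp only [Nat.pred_eq_sub_one]
    omega
  · simp [circleNormSq_eq_sum hp, eval_finsetSum]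

lemma exists_derivative_eq (Q : ℝ[X]) {n : ℕ} (hQ : Q.natDegree < n) (a : ℝ) :
    ∃ F : ℝ[X], F.natDegree ≤ n ∧ derivative F = Q ∧ F.eval a = 0 := by
  set G : ℝ[X] := ∑ i ∈ Finset.range n, C (Q.coeff i / (i + 1)) * X ^ (i + 1) with hG
  have hGd : G.natDegree ≤ n := natDegree_sum_le_of_forall_le _ _ fun i hi =>
    (natDegree_C_mul_X_pow_le _ _).trans (Finset.mem_range.mp hi)
  refine ⟨G - C (G.eval a), ?_, ?_, by simp⟩
  · rwa [natDegree_sub_C]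
  · rw [derivative_sub, derivative_C, sub_zero, hG, derivative_sum]
    conv_rhs => rw [Q.as_sum_range' n hQ]
    refine Finset.sum_congr rfl fun i _ => ?_
    rw [derivative_C_mul_X_pow, ← C_mul_X_pow_eq_monomial]
    have : (i : ℝ) + 1 ≠ 0 := by positivity
    push_cast
    rw [div_mul_cancel₀ _ this]

/-- Mass of a polynomial on an arc controls its mass on a slightly larger arc, with a constant
growing exponentially in the degree at a rate that vanishes as the arcs merge. -/
lemma integral_circleNormSq_le_of_integral_le {n : ℕ} {p : ℝ[X]} (hp : p.natDegree < n)
    {L L' τ σ M : ℝ} (hL : 0 < L) (hLL' : L ≤ L') (hL' : L' < π) (hτ : 0 ≤ τ) (hM : 0 < M)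
    (hσ : 0 < σ) (hσL : σ ≤ Real.sin L) (hσL' : σ ≤ Real.sin L')
    (hcos : Real.cos L' = (1 + Real.cos L) / 2 - Real.cosh τ * ((1 - Real.cos L) / 2))
    (hint : ∫ θ in (0 : ℝ)..L, circleNormSq p θ ≤ M) :
    ∫ θ in (0 : ℝ)..L', circleNormSq p θ ≤ M * (1 + Real.exp (n * τ) / σ) := by
  obtain ⟨Q, hQdeg, hQ⟩ := exists_eval_cos_eq_circleNormSq hp
  obtain ⟨F, hFdeg, hFQ, hF1⟩ := exists_derivative_eq Q hQdeg 1
  have hcont := continuous_circleNormSq p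
  have hcont' : Continuous fun θ => circleNormSq p θ * Real.sin θ := by fun_prop
  have hftc : ∀ a b : ℝ, ∫ θ in a..b, circleNormSq p θ * Real.sin θ =
      F.eval (Real.cos a) - F.eval (Real.cos b) := by
    intro a b
    rw [intervalIntegral.integral_eq_sub_of_hasDerivAt (f := fun θ => -F.eval (Real.cos θ))
      (fun θ _ => ?_) (hcont'.intervalIntegrable _ _)]
    · ring
    · have := ((F.hasDerivAt (Real.cos θ)).comp θ (Real.hasDerivAt_cos θ)).neg
      refine this.congr_deriv ?_
      rw [hFQ, hQ]
      ring
  have hsmall : ∀ θ ∈ Set.Icc 0 L, |F.eval (Real.cos θ)| ≤ M := by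
    intro θ hθ
    have h := hftc 0 θ
    rw [Real.cos_zero, hF1, zero_sub] at h
    rw [← abs_neg, ← h, abs_of_nonneg]
    · refine le_trans ?_ hint
      calc ∫ t in (0 : ℝ)..θ, circleNormSq p t * Real.sin t
          ≤ ∫ t in (0 : ℝ)..θ, circleNormSq p t := by
            refine intervalIntegral.integral_mono_on hθ.1 (hcont'.intervalIntegrable _ _)
              (hcont.intervalIntegrable _ _) fun t _ => ?_
            exact mul_le_of_le_one_right (circleNormSq_nonneg p t) (Real.sin_le_one t)
        _ ≤ ∫ t in (0 : ℝ)..L, circleNormSq p t :=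
            intervalIntegral.integral_mono_interval le_rfl hθ.1 hθ.2
              (Eventually.of_forall (circleNormSq_nonneg p)) (hcont.intervalIntegrable _ _)
    · refine intervalIntegral.integral_nonneg hθ.1 fun t ht => ?_
      exact mul_nonneg (circleNormSq_nonneg p t) (Real.sin_nonneg_of_nonneg_of_le_pi ht.1
        (by linarith [ht.2, hθ.2]))
  have hLcos : Real.cos L < 1 := by
    rw [← Real.cos_zero]
    exact Real.cos_lt_cos_of_nonneg_of_le_pi le_rfl (by linarith) hL
  have hgrow : -F.eval (Real.cos L') ≤ M * Real.exp (n * τ) := by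
    set P : ℝ[X] := C (-M⁻¹) * F.comp (C ((1 + Real.cos L) / 2) - X * C ((1 - Real.cos L) / 2))
      with hP
    have hPeval : ∀ t, P.eval t =
        -M⁻¹ * F.eval ((1 + Real.cos L) / 2 - t * ((1 - Real.cos L) / 2)) := by
      intro t
      simp only [hP, eval_mul, eval_comp, eval_sub, eval_C, eval_X]
    have hPdeg : P.degree ≤ n := by
      refine degree_le_of_natDegree_le ((natDegree_C_mul_le _ _).trans ?_)
      refine natDegree_comp_le.trans ?_
      have : (C ((1 + Real.cos L) / 2) - X * C ((1 - Real.cos L) / 2) : ℝ[X]).natDegree ≤ 1 := by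
        compute_degree
      nlinarith
    have hPbd : ∀ t ∈ Set.Icc (-1 : ℝ) 1, |P.eval t| ≤ 1 := by
      intro t ht
      set y := (1 + Real.cos L) / 2 - t * ((1 - Real.cos L) / 2) with hy
      have hy1 : y ≤ 1 := by nlinarith [ht.1]
      have hy2 : Real.cos L ≤ y := by nlinarith [ht.2]
      have hyc : Real.cos (Real.arccos y) = y :=
        Real.cos_arccos (by linarith [Real.neg_one_le_cos L]) hy1
      have hyL : Real.arccos y ≤ L := by
        rw [← Real.arccos_cos hL.le (by linarith)]
        exact Real.arccos_le_arccos hy2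
      have := hsmall _ ⟨Real.arccos_nonneg y, hyL⟩
      rw [hyc] at this
      rw [hPeval, ← hy, abs_mul, abs_neg, abs_of_pos (inv_pos.mpr hM), inv_mul_le_iff₀ hM]
      linarith
    have h := Chebyshev.eval_iterate_derivative_le_of_forall_abs_le_one (k := 0)
      (Real.one_le_cosh τ) hPdeg hPbd
    simp only [Function.iterate_zero, id_eq, Chebyshev.T_real_cosh, hPeval, ← hcos] at h
    have hcosh : Real.cosh (((n : ℤ) : ℝ) * τ) ≤ Real.exp (n * τ) := by
      rw [Real.cosh_eq]
      have : Real.exp (-(((n : ℤ) : ℝ) * τ)) ≤ Real.exp (n * τ) :=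
        Real.exp_le_exp.mpr (by push_cast; nlinarith [mul_nonneg (Nat.cast_nonneg (α := ℝ) n) hτ])
      push_cast at this ⊢
      linarith
    have h' := h.trans hcosh
    rw [neg_mul, ← mul_neg, inv_mul_le_iff₀ hM] at h'
    exact h'
  have hnear : σ * ∫ θ in L..L', circleNormSq p θ ≤ M * Real.exp (n * τ) := by
    calc σ * ∫ θ in L..L', circleNormSq p θ = ∫ θ in L..L', σ * circleNormSq p θ :=
          (intervalIntegral.integral_const_mul _ _).symm
      _ ≤ ∫ θ in L..L', circleNormSq p θ * Real.sin θ := by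
          refine intervalIntegral.integral_mono_on hLL'
            ((hcont.const_mul σ).intervalIntegrable _ _) (hcont'.intervalIntegrable _ _)
            fun t ht => ?_
          rw [mul_comm]
          refine mul_le_mul_of_nonneg_left ?_ (circleNormSq_nonneg p t)
          have hconc := strictConcaveOn_sin_Icc.concaveOn.min_le_of_mem_Icc
            (x := L) (y := L') (z := t) ⟨hL.le, by linarith⟩ ⟨by linarith, hL'.le⟩ ht
          exact (le_min hσL hσL').trans hconc
      _ ≤ ∫ θ in (0 : ℝ)..L', circleNormSq p θ * Real.sin θ := by
          refine intervalIntegral.integral_mono_interval hL.le hLL' le_rfl ?_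
            (hcont'.intervalIntegrable _ _)
          refine (ae_restrict_mem measurableSet_Ioc).mono fun t ht => ?_
          exact mul_nonneg (circleNormSq_nonneg p t)
            (Real.sin_nonneg_of_nonneg_of_le_pi ht.1.le (by linarith [ht.2]))
      _ ≤ M * Real.exp (n * τ) := by
          rw [hftc, Real.cos_zero, hF1, zero_sub]
          exact hgrow
  rw [← intervalIntegral.integral_add_adjacent_intervals
    (intervalIntegrable_circleNormSq p 0 L) (intervalIntegrable_circleNormSq p L L')]
  have : ∫ θ in L..L', circleNormSq p θ ≤ M * Real.exp (n * τ) / σ := by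
    rw [le_div_iff₀ hσ]
    linarith
  calc _ ≤ M + M * Real.exp (n * τ) / σ := add_le_add hint this
    _ = _ := by ring

end CircleNormSq

section Spectrum

open Polynomial Matrix

lemma isHermitian_arcMatrix (n : ℕ) (L : ℝ) : (arcMatrix n L).IsHermitian := by
  ext j k
  simp only [arcMatrix, conjTranspose_apply, of_apply, star_trivial, toeplitzCoeff]
  have h : ((j : ℕ) : ℤ) - ((k : ℕ) : ℤ) = -(((k : ℕ) : ℤ) - ((j : ℕ) : ℤ)) := by ring
  simp only [h, neg_eq_zero]
  split_ifs
  · rfl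
  · push_cast
    rw [neg_mul, Real.sin_neg, mul_neg, mul_neg, neg_div_neg_eq]

/-- The spectral theorem for real symmetric matrices in terms of matrix products. -/
lemma exists_orthogonal_diagonalization {n : ℕ} {A : Matrix (Fin n) (Fin n) ℝ}
    (hA : A.IsHermitian) : ∃ (U : Matrix (Fin n) (Fin n) ℝ) (ev : Fin n → ℝ),
      Uᵀ * U = 1 ∧ U * Uᵀ = 1 ∧ A = U * diagonal ev * Uᵀ := by
  refine ⟨hA.eigenvectorUnitary, hA.eigenvalues, ?_, ?_, ?_⟩
  · simpa [star_eq_conjTranspose] using Unitary.coe_star_mul_self hA.eigenvectorUnitary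
  · simpa [star_eq_conjTranspose] using Unitary.coe_mul_star_self hA.eigenvectorUnitary
  · have := hA.spectral_theorem
    rw [Unitary.conjStarAlgAut_apply] at this
    simpa [star_eq_conjTranspose, Function.comp_def] using this

variable {n : ℕ} {L : ℝ} {U : Matrix (Fin n) (Fin n) ℝ} {ev : Fin n → ℝ}

lemma dotProduct_self_eq_sum (hU' : U * Uᵀ = 1) (v : Fin n → ℝ) :
    v ⬝ᵥ v = ∑ j, (Uᵀ *ᵥ v) j ^ 2 := by
  have : v ⬝ᵥ v = (Uᵀ *ᵥ v) ⬝ᵥ (Uᵀ *ᵥ v) := by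
    rw [dotProduct_mulVec, vecMul_transpose, mulVec_mulVec, hU', one_mulVec]
  rw [this]
  simp [dotProduct, sq]

lemma dotProduct_mulVec_eq_sum {A : Matrix (Fin n) (Fin n) ℝ} (hA : A = U * diagonal ev * Uᵀ)
    (v : Fin n → ℝ) : v ⬝ᵥ A *ᵥ v = ∑ j, ev j * (Uᵀ *ᵥ v) j ^ 2 := by
  have : v ⬝ᵥ A *ᵥ v = (Uᵀ *ᵥ v) ⬝ᵥ (diagonal ev *ᵥ (Uᵀ *ᵥ v)) := by
    rw [hA, mulVec_transpose, ← dotProduct_mulVec, ← mulVec_transpose, mulVec_mulVec,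
      mulVec_mulVec]
  rw [this]
  simp only [dotProduct, mulVec_diagonal]
  exact Finset.sum_congr rfl fun j _ => by ring

lemma natDegree_lt_of_mem_degreeLT {p : ℝ[X]} {m : ℕ} (hm : 0 < m) (hp : p ∈ degreeLT ℝ m) :
    p.natDegree < m := by
  rcases eq_or_ne p 0 with rfl | h0
  · simpa using hm
  · exact (natDegree_lt_iff_degree_lt h0).mpr (mem_degreeLT.mp hp)

lemma exists_coeff_eq (hn : 0 < n) (v : Fin n → ℝ) :
    ∃ p : ℝ[X], p.natDegree < n ∧ (fun i : Fin n => p.coeff i) = v := by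
  refine ⟨((degreeLTEquiv ℝ n).symm v : ℝ[X]),
    natDegree_lt_of_mem_degreeLT hn ((degreeLTEquiv ℝ n).symm v).2, ?_⟩
  exact (degreeLTEquiv ℝ n).apply_symm_apply v

lemma eigenvalue_arcMatrix_mem_Icc (hL : L ∈ Set.Icc 0 π) (hU : Uᵀ * U = 1) (hU' : U * Uᵀ = 1)
    (hA : arcMatrix n L = U * diagonal ev * Uᵀ) (i : Fin n) : ev i ∈ Set.Icc 0 1 := by
  obtain ⟨p, hp, hpv⟩ := exists_coeff_eq (Fin.pos i) (U *ᵥ Pi.single i 1)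
  have hsingle : Uᵀ *ᵥ (U *ᵥ Pi.single i 1) = Pi.single i 1 := by
    rw [mulVec_mulVec, hU, one_mulVec]
  have h1 := integral_circleNormSq hp L
  have h2 := integral_circleNormSq_pi hp
  rw [hpv, dotProduct_mulVec_eq_sum hA, hsingle] at h1
  rw [hpv, dotProduct_self_eq_sum hU', hsingle] at h2
  simp only [Pi.single_apply, ite_pow, one_pow, ne_eq, OfNat.ofNat_ne_zero, not_false_eq_true,
    zero_pow, mul_ite, mul_one, mul_zero, Finset.sum_ite_eq', Finset.mem_univ, if_true] at h1 h2
  have h3 : 0 ≤ ∫ θ in (0 : ℝ)..L, circleNormSq p θ :=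
    intervalIntegral.integral_nonneg hL.1 fun t _ => circleNormSq_nonneg p t
  have h4 : ∫ θ in (0 : ℝ)..L, circleNormSq p θ ≤ ∫ θ in (0 : ℝ)..π, circleNormSq p θ :=
    intervalIntegral.integral_mono_interval le_rfl hL.1 hL.2
      (Eventually.of_forall (circleNormSq_nonneg p)) (intervalIntegrable_circleNormSq p 0 π)
  rw [h1] at h3
  rw [h1, h2] at h4
  exact ⟨nonneg_of_mul_nonneg_right h3 Real.pi_pos,
    le_of_mul_le_mul_left (by linarith) Real.pi_pos⟩

/-- Dimension count: a nonzero polynomial of degree less than `n - d` that is a combination of the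
eigenvectors indexed by `J`, and whose product with `(X - 1) ^ d` is orthogonal to the
eigenvectors indexed by `I`. -/
lemma exists_polynomial_ne_zero (U : Matrix (Fin n) (Fin n) ℝ) {I J : Finset (Fin n)} {d : ℕ}
    (hcard : I.card + d < J.card) : ∃ p : ℝ[X], p ≠ 0 ∧ p ∈ degreeLT ℝ (n - d) ∧
      (∀ j ∉ J, (Uᵀ *ᵥ fun i : Fin n => p.coeff i) j = 0) ∧
      ∀ j ∈ I, (Uᵀ *ᵥ fun i : Fin n => (p * (X - 1) ^ d).coeff i) j = 0 := by
  let c : ℝ[X] →ₗ[ℝ] Fin n → ℝ := (Uᵀ).mulVecLin ∘ₗ LinearMap.pi fun i : Fin n => lcoeff ℝ i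
  let f : degreeLT ℝ (n - d) →ₗ[ℝ] ({j // j ∈ Jᶜ} → ℝ) × ({j // j ∈ I} → ℝ) :=
    (LinearMap.funLeft ℝ ℝ Subtype.val ∘ₗ c ∘ₗ (degreeLT ℝ (n - d)).subtype).prod
      (LinearMap.funLeft ℝ ℝ Subtype.val ∘ₗ c ∘ₗ LinearMap.mulRight ℝ ((X - 1) ^ d) ∘ₗ
        (degreeLT ℝ (n - d)).subtype)
  have hfin : FiniteDimensional ℝ (degreeLT ℝ (n - d)) :=
    (degreeLTEquiv ℝ (n - d)).symm.finiteDimensional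
  have hrank : Module.finrank ℝ (({j // j ∈ Jᶜ} → ℝ) × ({j // j ∈ I} → ℝ)) <
      Module.finrank ℝ (degreeLT ℝ (n - d)) := by
    rw [(degreeLTEquiv ℝ (n - d)).finrank_eq, Module.finrank_prod, Module.finrank_pi,
      Module.finrank_pi, Module.finrank_pi, Fintype.card_coe, Fintype.card_coe, Fintype.card_fin,
      Finset.card_compl, Fintype.card_fin]
    have := Finset.card_le_univ J
    rw [Fintype.card_fin] at this
    omega
  obtain ⟨p, hpker, hp0⟩ := (Submodule.ne_bot_iff _).mp (f.ker_ne_bot_of_finrank_lt hrank)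
  have hp := Prod.ext_iff.mp (LinearMap.mem_ker.mp hpker)
  refine ⟨p, by simpa using hp0, p.2, fun j hj => ?_, fun j hj => ?_⟩
  · exact congrFun hp.1 ⟨j, by simpa using hj⟩
  · exact congrFun hp.2 ⟨j, hj⟩

/-- Few eigenvalues of the arc matrix lie in a short multiplicative window `(l, u]`. -/
lemma card_eigenvalues_le_add {L' τ σ l u : ℝ} {d : ℕ} (hL : 0 < L) (hLL' : L < L') (hL' : L' < π)
    (hτ : 0 ≤ τ) (hσ : 0 < σ) (hσL : σ ≤ Real.sin L) (hσL' : σ ≤ Real.sin L')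
    (hcos : Real.cos L' = (1 + Real.cos L) / 2 - Real.cosh τ * ((1 - Real.cos L) / 2))
    (hU' : U * Uᵀ = 1) (hA : arcMatrix n L = U * diagonal ev * Uᵀ)
    (hl : 0 < l) (hu : 0 < u) (hsmall : u * (1 + Real.exp (n * τ) / σ) ≤ 1 / 2)
    (hlu : 2 * u < l * ((1 - Real.cos L') / (1 - Real.cos L)) ^ d) :
    (Finset.univ.filter fun j => ev j ≤ u).card ≤
      (Finset.univ.filter fun j => ev j ≤ l).card + d := by
  by_contra! hcard
  obtain ⟨p, hp0, hpdeg, hpJ, hqI⟩ := exists_polynomial_ne_zero U hcard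
  have hdn : d < n := by
    have := Finset.card_le_univ (Finset.univ.filter fun j : Fin n => ev j ≤ u)
    rw [Fintype.card_fin] at this
    omega
  have hpnat := natDegree_lt_of_mem_degreeLT (by omega) hpdeg
  have hpn : p.natDegree < n := by omega
  set q := p * (X - 1) ^ d with hq
  have hqn : q.natDegree < n := by
    have : ((X - 1 : ℝ[X]) ^ d).natDegree ≤ d := by
      refine natDegree_pow_le.trans ?_
      have : (X - 1 : ℝ[X]).natDegree ≤ 1 := by compute_degree
      nlinarith
    have := natDegree_mul_le (p := p) (q := (X - 1) ^ d)
    rw [← hq] at this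
    omega
  set N := ∫ θ in (0 : ℝ)..π, circleNormSq p θ with hN
  have hNpos : 0 < N := by
    rw [hN, integral_circleNormSq_pi hpn]
    refine mul_pos Real.pi_pos ?_
    rw [dotProduct]
    refine Finset.sum_pos' (fun i _ => mul_self_nonneg _) ⟨⟨p.natDegree, hpn⟩, Finset.mem_univ _, ?_⟩
    exact mul_self_pos.mpr (by simpa using hp0)
  have hparc : ∫ θ in (0 : ℝ)..L, circleNormSq p θ ≤ u * N := by
    rw [hN, integral_circleNormSq_pi hpn, integral_circleNormSq hpn, dotProduct_mulVec_eq_sum hA,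
      dotProduct_self_eq_sum hU', mul_left_comm, Finset.mul_sum _ _ u]
    refine mul_le_mul_of_nonneg_left (Finset.sum_le_sum fun j _ => ?_) Real.pi_pos.le
    by_cases hj : ev j ≤ u
    · exact mul_le_mul_of_nonneg_right hj (sq_nonneg _)
    · rw [hpJ j (by simpa using hj)]
      simp
  have hqarc : l * ∫ θ in (0 : ℝ)..π, circleNormSq q θ ≤
      ∫ θ in (0 : ℝ)..L, circleNormSq q θ := by
    rw [integral_circleNormSq_pi hqn, integral_circleNormSq hqn, dotProduct_mulVec_eq_sum hA,
      dotProduct_self_eq_sum hU', mul_left_comm, Finset.mul_sum _ _ l]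
    refine mul_le_mul_of_nonneg_left (Finset.sum_le_sum fun j _ => ?_) Real.pi_pos.le
    by_cases hj : ev j ≤ l
    · rw [hqI j (by simpa using hj)]
      simp
    · exact mul_le_mul_of_nonneg_right (not_le.mp hj).le (sq_nonneg _)
  have hfar : N / 2 ≤ ∫ θ in L'..π, circleNormSq p θ := by
    have h1 := integral_circleNormSq_le_of_integral_le hpn hL hLL'.le hL' hτ (mul_pos hu hNpos)
      hσ hσL hσL' hcos hparc
    have h2 := intervalIntegral.integral_add_adjacent_intervals
      (intervalIntegrable_circleNormSq p 0 L') (intervalIntegrable_circleNormSq p L' π)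
    have h3 : u * N * (1 + Real.exp (n * τ) / σ) ≤ N / 2 := by nlinarith
    rw [← hN] at h2
    linarith
  have hκ : 0 < 1 - Real.cos L := by
    have := Real.cos_lt_cos_of_nonneg_of_le_pi le_rfl (by linarith) hL
    rw [Real.cos_zero] at this
    linarith
  have hκ' : 0 ≤ 1 - Real.cos L' := by linarith [Real.cos_le_one L']
  have hupper : ∫ θ in (0 : ℝ)..L, circleNormSq q θ ≤
      (2 * (1 - Real.cos L)) ^ d * ∫ θ in (0 : ℝ)..L, circleNormSq p θ := by
    rw [← intervalIntegral.integral_const_mul]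
    refine intervalIntegral.integral_mono_on hL.le (intervalIntegrable_circleNormSq q _ _)
      ((intervalIntegrable_circleNormSq p _ _).const_mul _) fun t ht => ?_
    rw [hq, circleNormSq_mul_X_sub_one_pow, mul_comm]
    have := Real.cos_le_cos_of_nonneg_of_le_pi ht.1 (by linarith) ht.2
    have := Real.cos_le_one t
    refine mul_le_mul_of_nonneg_right (pow_le_pow_left₀ (by linarith) (by linarith) d)
      (circleNormSq_nonneg p t)
  have hlower : (2 * (1 - Real.cos L')) ^ d * ∫ θ in L'..π, circleNormSq p θ ≤
      ∫ θ in (0 : ℝ)..π, circleNormSq q θ := by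
    calc _ ≤ ∫ θ in L'..π, circleNormSq q θ := by
          rw [← intervalIntegral.integral_const_mul]
          refine intervalIntegral.integral_mono_on hL'.le
            ((intervalIntegrable_circleNormSq p _ _).const_mul _)
            (intervalIntegrable_circleNormSq q _ _) fun t ht => ?_
          rw [hq, circleNormSq_mul_X_sub_one_pow, mul_comm (circleNormSq p t)]
          have := Real.cos_le_cos_of_nonneg_of_le_pi (by linarith) ht.2 ht.1
          refine mul_le_mul_of_nonneg_right (pow_le_pow_left₀ (by linarith) (by linarith) d)
            (circleNormSq_nonneg p t)
      _ ≤ _ := intervalIntegral.integral_mono_interval (by linarith) hL'.le le_rfl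
          (Eventually.of_forall (circleNormSq_nonneg q)) (intervalIntegrable_circleNormSq q 0 π)
  have hκd : 0 < (2 * (1 - Real.cos L)) ^ d := by positivity
  have hratio : (2 * (1 - Real.cos L')) ^ d = (2 * (1 - Real.cos L)) ^ d *
      ((1 - Real.cos L') / (1 - Real.cos L)) ^ d := by
    rw [← mul_pow]
    congr 1
    field_simp
  set ρd := ((1 - Real.cos L') / (1 - Real.cos L)) ^ d with hρd
  have hρ0 : 0 ≤ ρd := by positivity
  have hchain : l * ((2 * (1 - Real.cos L)) ^ d * ρd * (N / 2)) ≤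
      (2 * (1 - Real.cos L)) ^ d * (u * N) := by
    calc _ ≤ l * ((2 * (1 - Real.cos L)) ^ d * ρd * ∫ θ in L'..π, circleNormSq p θ) := by gcongr
      _ ≤ l * ∫ θ in (0 : ℝ)..π, circleNormSq q θ := by
          rw [← hratio]
          gcongr
      _ ≤ _ := hqarc.trans (hupper.trans (by gcongr))
  have : (2 * (1 - Real.cos L)) ^ d * N * (l * ρd) ≤ (2 * (1 - Real.cos L)) ^ d * N * (2 * u) := by
    linarith
  exact absurd (le_of_mul_le_mul_left this (by positivity)) (not_le.mpr hlu)

end Spectrum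

section Variance

open Matrix

variable {n : ℕ} {L : ℝ} {U : Matrix (Fin n) (Fin n) ℝ} {ev : Fin n → ℝ}

lemma toeplitzDet_eq_prod (hU' : U * Uᵀ = 1) (hA : arcMatrix n L = U * diagonal ev * Uᵀ) (s : ℝ) :
    toeplitzDet n s L = ∏ j, (ev j + s * (1 - ev j)) := by
  have hT : (Matrix.of fun j k : Fin n => toeplitzCoeff L s (((k : ℕ) : ℤ) - ((j : ℕ) : ℤ))) =
      arcMatrix n L + s • (1 - arcMatrix n L) := by
    ext j k
    have h : ((k : ℕ) : ℤ) - ((j : ℕ) : ℤ) = 0 ↔ j = k := by rw [Fin.ext_iff]; omega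
    simp only [arcMatrix, toeplitzCoeff, of_apply, Matrix.add_apply, Matrix.smul_apply,
      Matrix.sub_apply, one_apply, h, smul_eq_mul]
    split_ifs
    · field_simp
      ring
    · ring
  have hD : arcMatrix n L + s • (1 - arcMatrix n L) =
      U * diagonal (fun j => ev j + s * (1 - ev j)) * Uᵀ := by
    have hd : diagonal (fun j => ev j + s * (1 - ev j)) =
        diagonal ev + s • ((1 : Matrix (Fin n) (Fin n) ℝ) - diagonal ev) := by
      ext j k
      by_cases h : j = k
      · subst h
        simp
      · simp [h]
    rw [hd, hA, Matrix.mul_add, Matrix.add_mul, Matrix.mul_smul, Matrix.smul_mul, Matrix.mul_sub,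
      Matrix.sub_mul, Matrix.mul_one, hU']
  rw [toeplitzDet, hT, hD, det_mul_right_comm, hU', Matrix.one_mul, det_diagonal]

lemma bernoulli_generating_pos {a s : ℝ} (ha : a ∈ Set.Icc (0 : ℝ) 1) (hs : 0 < s) :
    0 < a + s * (1 - a) := by
  rcases ha.1.eq_or_lt with h | h
  · simpa [← h] using hs
  · have := mul_nonneg hs.le (sub_nonneg.mpr ha.2)
    linarith

/-- The tilted variance of a sum of independent Bernoulli variables, through the logarithmic
derivatives of its generating function. -/
lemma deriv_log_prod_eq_sum {D : ℝ → ℝ} (hev : ∀ j, ev j ∈ Set.Icc (0 : ℝ) 1)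
    (hD : ∀ s, D s = ∏ j, (ev j + s * (1 - ev j))) {s : ℝ} (hs : 0 < s) :
    s ^ 2 * deriv (deriv fun t => Real.log (D t)) s + s * deriv (fun t => Real.log (D t)) s =
      ∑ j, ev j * (s * (1 - ev j)) / (ev j + s * (1 - ev j)) ^ 2 := by
  have hlin : ∀ (j : Fin n) (t : ℝ), HasDerivAt (fun t => ev j + t * (1 - ev j)) (1 - ev j) t :=
    fun j t => by simpa using ((hasDerivAt_id t).mul_const (1 - ev j)).const_add (ev j)
  have h1 : ∀ t > 0, HasDerivAt (fun t => Real.log (D t))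
      (∑ j, (1 - ev j) / (ev j + t * (1 - ev j))) t := by
    intro t ht
    have hsum : HasDerivAt (fun t => ∑ j, Real.log (ev j + t * (1 - ev j)))
        (∑ j, (1 - ev j) / (ev j + t * (1 - ev j))) t :=
      HasDerivAt.fun_sum fun j _ => (hlin j t).log (bernoulli_generating_pos (hev j) ht).ne'
    refine hsum.congr_of_eventuallyEq ?_
    filter_upwards [lt_mem_nhds ht] with r hr
    rw [hD, Real.log_prod fun j _ => (bernoulli_generating_pos (hev j) hr).ne']
  have h2 : HasDerivAt (deriv fun t => Real.log (D t))
      (∑ j, -((1 - ev j) * (1 - ev j)) / (ev j + s * (1 - ev j)) ^ 2) s := by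
    have hsum : HasDerivAt (fun t => ∑ j, (1 - ev j) / (ev j + t * (1 - ev j)))
        (∑ j, -((1 - ev j) * (1 - ev j)) / (ev j + s * (1 - ev j)) ^ 2) s :=
      HasDerivAt.fun_sum fun j _ =>
        ((hasDerivAt_const s (1 - ev j)).div (hlin j s)
          (bernoulli_generating_pos (hev j) hs).ne').congr_deriv (by simp)
    refine hsum.congr_of_eventuallyEq ?_
    filter_upwards [lt_mem_nhds hs] with r hr
    exact (h1 r hr).deriv
  rw [h2.deriv, (h1 s hs).deriv, Finset.mul_sum, Finset.mul_sum, ← Finset.sum_add_distrib]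
  refine Finset.sum_congr rfl fun j _ => ?_
  have := (bernoulli_generating_pos (hev j) hs).ne'
  field_simp
  ring

/-- Away from the window `(l, u]` a Bernoulli variable contributes little to the tilted variance. -/
lemma bernoulli_variance_le {a s l u : ℝ} (ha : a ∈ Set.Icc (0 : ℝ) 1) (hs : 0 < s) (hl : 0 < l)
    (hl2 : l ≤ 1 / 2) (hu : 0 < u) :
    a * (s * (1 - a)) / (a + s * (1 - a)) ^ 2 ≤
      s / u + 2 * l / s + if l < a ∧ a ≤ u then 1 else 0 := by
  have hpos := bernoulli_generating_pos ha hs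
  have hb : 0 ≤ s * (1 - a) := mul_nonneg hs.le (sub_nonneg.mpr ha.2)
  have hsu : 0 ≤ s / u := by positivity
  have hls : 0 ≤ 2 * l / s := by positivity
  by_cases hal : a ≤ l
  · have h : a * (s * (1 - a)) / (a + s * (1 - a)) ^ 2 ≤ 2 * l / s := by
      rw [div_le_div_iff₀ (by positivity) hs]
      have h1 : (s * (1 - a)) ^ 2 ≤ (a + s * (1 - a)) ^ 2 := by nlinarith [ha.1]
      have h2 : s ^ 2 * (1 - a) * a ≤ s ^ 2 * (1 - a) * (2 * l * (1 - a)) := by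
        refine mul_le_mul_of_nonneg_left ?_ (by nlinarith [ha.2, sq_nonneg s])
        nlinarith
      nlinarith
    split_ifs <;> linarith
  · by_cases hau : a ≤ u
    · rw [if_pos ⟨not_le.mp hal, hau⟩]
      have h : a * (s * (1 - a)) / (a + s * (1 - a)) ^ 2 ≤ 1 := by
        rw [div_le_one (by positivity)]
        nlinarith [ha.1, mul_nonneg ha.1 hb]
      linarith
    · have hua := not_le.mp hau
      have h : a * (s * (1 - a)) / (a + s * (1 - a)) ^ 2 ≤ s / u := by
        rw [div_le_div_iff₀ (by positivity) hu]
        have h1 : a ^ 2 ≤ (a + s * (1 - a)) ^ 2 := by nlinarith [ha.1]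
        have h2 : a * (s * (1 - a)) * u ≤ a * s * a := by
          have : (1 - a) * u ≤ a := by nlinarith [ha.1, ha.2]
          nlinarith [mul_nonneg ha.1 hs.le]
        nlinarith
      split_ifs <;> linarith

lemma exists_larger_arc (hL : L ∈ Set.Ioo 0 π) {x : ℝ} (hx : 0 < x) :
    ∃ τ L' : ℝ, 0 ≤ τ ∧ τ < x ∧ L < L' ∧ L' < π ∧
      Real.cos L' = (1 + Real.cos L) / 2 - Real.cosh τ * ((1 - Real.cos L) / 2) := by
  set y : ℝ → ℝ := fun τ => (1 + Real.cos L) / 2 - Real.cosh τ * ((1 - Real.cos L) / 2) with hy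
  have hc1 : -1 < Real.cos L := by
    rw [← Real.cos_pi]
    exact Real.cos_lt_cos_of_nonneg_of_le_pi hL.1.le le_rfl hL.2
  have hc2 : Real.cos L < 1 := by
    rw [← Real.cos_zero]
    exact Real.cos_lt_cos_of_nonneg_of_le_pi le_rfl hL.2.le hL.1
  have hcont : Continuous y := by
    have := Real.continuous_cosh
    fun_prop
  have hy0 : -1 < y 0 := by
    simp only [hy, Real.cosh_zero]
    linarith
  have hev : ∀ᶠ τ in nhdsWithin 0 (Set.Ioi 0), -1 < y τ :=
    (hcont.continuousAt.eventually (lt_mem_nhds hy0)).filter_mono nhdsWithin_le_nhds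
  obtain ⟨τ, hτy, hτ⟩ := (hev.and (Ioo_mem_nhdsGT hx)).exists
  have hτc : y τ < Real.cos L := by
    have := Real.one_lt_cosh.mpr hτ.1.ne'
    simp only [hy]
    nlinarith
  refine ⟨τ, Real.arccos (y τ), hτ.1.le, hτ.2, ?_, ?_, ?_⟩
  · rw [← Real.arccos_cos hL.1.le hL.2.le]
    exact Real.arccos_lt_arccos hτy.le hτc (Real.cos_le_one L)
  · rw [← Real.arccos_neg_one]
    exact Real.arccos_lt_arccos le_rfl hτy (by linarith)
  · exact Real.cos_arccos hτy.le (by linarith)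

lemma variance_le {L' τ σ x ε : ℝ} {d : ℕ} (hL : 0 < L) (hLL' : L < L') (hL' : L' < π)
    (hτ : 0 ≤ τ) (hσ : 0 < σ) (hσL : σ ≤ Real.sin L) (hσL' : σ ≤ Real.sin L')
    (hcos : Real.cos L' = (1 + Real.cos L) / 2 - Real.cosh τ * ((1 - Real.cos L) / 2))
    (hε : 0 ≤ ε)
    (hsmall : Real.exp (-(x - ε) * n) * (1 + Real.exp (n * τ) / σ) ≤ 1 / 2)
    (hlu : 2 * Real.exp (-(x - ε) * n) <
      Real.exp (-(x + ε) * n) * ((1 - Real.cos L') / (1 - Real.cos L)) ^ d)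
    (hU' : U * Uᵀ = 1) (hA : arcMatrix n L = U * diagonal ev * Uᵀ)
    (hev : ∀ j, ev j ∈ Set.Icc (0 : ℝ) 1) :
    ∑ j, ev j * (Real.exp (-x * n) * (1 - ev j)) /
      (ev j + Real.exp (-x * n) * (1 - ev j)) ^ 2 ≤ n * (3 * Real.exp (-ε * n)) + d := by
  set s := Real.exp (-x * n) with hs
  set u := Real.exp (-(x - ε) * n) with hu
  set l := Real.exp (-(x + ε) * n) with hl
  have hlu' : l ≤ u := by
    refine Real.exp_le_exp.mpr ?_
    nlinarith [mul_nonneg hε (Nat.cast_nonneg (α := ℝ) n)]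
  have hl2 : l ≤ 1 / 2 := by
    refine hlu'.trans (le_trans ?_ hsmall)
    refine le_mul_of_one_le_right (Real.exp_pos _).le ?_
    have : 0 ≤ Real.exp (n * τ) / σ := by positivity
    linarith
  have hcard := card_eigenvalues_le_add hL hLL' hL' hτ hσ hσL hσL' hcos hU' hA
    (Real.exp_pos _) (Real.exp_pos _) hsmall hlu
  rw [← hu, ← hl] at hcard
  have hwindow : (Finset.univ.filter fun j => l < ev j ∧ ev j ≤ u).card ≤ d := by
    have hsub : (Finset.univ.filter fun j => l < ev j ∧ ev j ≤ u) =
        (Finset.univ.filter fun j => ev j ≤ u) \ Finset.univ.filter fun j => ev j ≤ l := by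
      ext j
      simp [and_comm]
    rw [hsub, Finset.card_sdiff_of_subset]
    · omega
    · exact Finset.monotone_filter_right _ fun j _ hj => hj.trans hlu'
  have hsu : s / u = Real.exp (-ε * n) := by
    rw [hs, hu, ← Real.exp_sub]
    ring_nf
  have hls : 2 * l / s = 2 * Real.exp (-ε * n) := by
    rw [hs, hl, mul_div_assoc, ← Real.exp_sub]
    ring_nf
  calc _ ≤ ∑ j, (s / u + 2 * l / s + if l < ev j ∧ ev j ≤ u then 1 else 0) :=
        Finset.sum_le_sum fun j _ => bernoulli_variance_le (hev j) (Real.exp_pos _)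
          (Real.exp_pos _) hl2 (Real.exp_pos _)
    _ = n * (3 * Real.exp (-ε * n)) + (Finset.univ.filter fun j => l < ev j ∧ ev j ≤ u).card := by
        rw [Finset.sum_add_distrib, Finset.sum_const, Finset.card_univ, Fintype.card_fin,
          Finset.sum_boole, hsu, hls, nsmul_eq_mul]
        ring
    _ ≤ _ := by
        gcongr

lemma tendsto_exp_neg_mul_natCast {a : ℝ} (ha : 0 < a) :
    Tendsto (fun n : ℕ => Real.exp (-a * n)) atTop (nhds 0) := by
  refine Real.tendsto_exp_atBot.comp ?_
  exact tendsto_natCast_atTop_atTop.const_mul_atTop_of_neg (by linarith)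

end Variance

theorem stmt10 (L x xc : ℝ) (hL : L ∈ Set.Ioo 0 π)
    (hxc : xc = -2 * Real.log (Real.tan (L / 4))) (hx : x ∈ Set.Ioo 0 xc) :
    Tendsto (fun n : ℕ => (1 / (n : ℝ)) *
        (Real.exp (-x * n) ^ 2 *
            deriv (deriv (fun s => Real.log (toeplitzDet n s L))) (Real.exp (-x * n)) +
          Real.exp (-x * n) * deriv (fun s => Real.log (toeplitzDet n s L)) (Real.exp (-x * n))))
      atTop (nhds 0) := by
  obtain ⟨τ, L', hτ, hτx, hLL', hL', hcos⟩ := exists_larger_arc hL (x := x / 4) (by linarith [hx.1])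
  set σ := min (Real.sin L) (Real.sin L')
  have hσ : 0 < σ := lt_min (Real.sin_pos_of_pos_of_lt_pi hL.1 hL.2)
    (Real.sin_pos_of_pos_of_lt_pi (hL.1.trans hLL') hL')
  have hcosL : Real.cos L' < Real.cos L :=
    Real.cos_lt_cos_of_nonneg_of_le_pi hL.1.le hL'.le hLL'
  have hκ : 0 < 1 - Real.cos L := by
    have := Real.cos_lt_cos_of_nonneg_of_le_pi le_rfl hL.2.le hL.1
    rw [Real.cos_zero] at this
    linarith
  set ρ := (1 - Real.cos L') / (1 - Real.cos L)
  have hρ : 1 < ρ := (one_lt_div hκ).mpr (by linarith)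
  have hlogρ : 0 < Real.log ρ := Real.log_pos hρ
  have hx0 : 0 < x := hx.1
  choose U ev hU hU' hA using fun n : ℕ =>
    exists_orthogonal_diagonalization (isHermitian_arcMatrix n L)
  have hev : ∀ n j, ev n j ∈ Set.Icc (0 : ℝ) 1 := fun n =>
    eigenvalue_arcMatrix_mem_Icc ⟨hL.1.le, hL.2.le⟩ (hU n) (hU' n) (hA n)
  have hvar := fun n : ℕ => deriv_log_prod_eq_sum (hev n) (toeplitzDet_eq_prod (hU' n) (hA n))
    (Real.exp_pos (-x * n))
  simp_rw [hvar]
  refine tendsto_order.2 ⟨fun a ha => Eventually.of_forall fun n => lt_of_lt_of_le ha ?_,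
    fun b hb => ?_⟩
  · refine mul_nonneg (by positivity) (Finset.sum_nonneg fun j _ => ?_)
    have h1 := (hev n j).1
    have h2 := sub_nonneg.mpr (hev n j).2
    positivity
  set δ := b / 2 with hδ
  have hδ0 : 0 < δ := by positivity
  set ε := min (δ * Real.log ρ / 4) (x / 2) with hε
  have hε0 : 0 < ε := lt_min (by positivity) (by positivity)
  have hε1 : ε ≤ δ * Real.log ρ / 4 := min_le_left _ _
  have hε2 : ε ≤ x / 2 := min_le_right _ _
  have lim1 : Tendsto (fun n : ℕ => Real.exp (-(x / 2) * n) + Real.exp (-(x / 4) * n) / σ) atTop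
      (nhds 0) := by
    simpa using (tendsto_exp_neg_mul_natCast (half_pos hx0)).add
      ((tendsto_exp_neg_mul_natCast (a := x / 4) (by positivity)).div_const σ)
  have lim2 := tendsto_exp_neg_mul_natCast (a := δ * Real.log ρ / 2) (by positivity)
  have lim3 : Tendsto (fun n : ℕ => 3 * Real.exp (-ε * n) + 1 / (n : ℝ)) atTop (nhds 0) := by
    simpa using ((tendsto_exp_neg_mul_natCast hε0).const_mul 3).add
      tendsto_one_div_atTop_nhds_zero_nat
  filter_upwards [lim1.eventually_lt_const (show (0 : ℝ) < 1 / 2 by norm_num),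
    lim2.eventually_lt_const (show (0 : ℝ) < 1 / 2 by norm_num),
    lim3.eventually_lt_const hδ0, eventually_gt_atTop 0] with n h1 h2 h3 hn
  have hn0 : (0 : ℝ) < n := by exact_mod_cast hn
  have hsmall : Real.exp (-(x - ε) * n) * (1 + Real.exp (n * τ) / σ) ≤ 1 / 2 := by
    have he1 : Real.exp (-(x - ε) * n) ≤ Real.exp (-(x / 2) * n) :=
      Real.exp_le_exp.mpr (by nlinarith)
    have he2 : Real.exp (-(x - ε) * n) * Real.exp (n * τ) ≤ Real.exp (-(x / 4) * n) := by
      rw [← Real.exp_add]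
      exact Real.exp_le_exp.mpr (by nlinarith)
    calc _ = Real.exp (-(x - ε) * n) + Real.exp (-(x - ε) * n) * Real.exp (n * τ) / σ := by ring
      _ ≤ Real.exp (-(x / 2) * n) + Real.exp (-(x / 4) * n) / σ := by gcongr
      _ ≤ 1 / 2 := h1.le
  have hlu : 2 * Real.exp (-(x - ε) * n) < Real.exp (-(x + ε) * n) * ρ ^ ⌈δ * n⌉₊ := by
    have hpow : Real.exp (δ * n * Real.log ρ) ≤ ρ ^ ⌈δ * n⌉₊ := by
      rw [← Real.exp_log (show 0 < ρ by linarith), ← Real.exp_nat_mul, Real.log_exp]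
      exact Real.exp_le_exp.mpr (mul_le_mul_of_nonneg_right (Nat.le_ceil _) hlogρ.le)
    have hexp : Real.exp (-(x - ε) * n) = Real.exp (-(x + ε) * n) * Real.exp (2 * ε * n) := by
      rw [← Real.exp_add]
      ring_nf
    have hexp2 : Real.exp (2 * ε * n) ≤
        Real.exp (-(δ * Real.log ρ / 2) * n) * Real.exp (δ * n * Real.log ρ) := by
      rw [← Real.exp_add]
      exact Real.exp_le_exp.mpr (by nlinarith)
    have hexp3 : 2 * Real.exp (2 * ε * n) < Real.exp (δ * n * Real.log ρ) := by
      nlinarith [Real.exp_pos (δ * n * Real.log ρ)]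
    rw [hexp]
    nlinarith [Real.exp_pos (-(x + ε) * n)]
  have hV := variance_le hL.1 hLL' hL' hτ hσ (min_le_left _ _) (min_le_right _ _) hcos hε0.le
    hsmall hlu (hU' n) (hA n) (hev n)
  have hceil : (⌈δ * n⌉₊ : ℝ) < δ * n + 1 := Nat.ceil_lt_add_one (by positivity)
  calc _ ≤ 1 / (n : ℝ) * (n * (3 * Real.exp (-ε * n)) + ⌈δ * n⌉₊) :=
        mul_le_mul_of_nonneg_left hV (by positivity)
    _ ≤ 1 / (n : ℝ) * (n * (3 * Real.exp (-ε * n)) + (δ * n + 1)) := by gcongr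
    _ = 3 * Real.exp (-ε * n) + 1 / (n : ℝ) + δ := by
        field_simp
        ring
    _ < b := by linarith
end

section
/- Fix L ∈ (0, π) and s ∈ (0, 1), both independent of n. Let ν_n = (1/n) Σ_{z : φ_n(z)=0} δ_z be the normalized zero counting measure of φ_n (zeros counted with multiplicity). Then ν_n converges weakly, as n → ∞, to the uniform probability measure (normalized arclength measure dθ/(2π)) on the unit circle. -/
open Real Filter MeasureTheory

/-- The weight on the unit circle: `f(e^{iθ}) = 1` for `θ ∈ (-L,L)` (mod 2π), i.e. when
`cos θ > cos L`, and `f(e^{iθ}) = s` otherwise. -/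
noncomputable def weight (L s θ : ℝ) : ℝ := if Real.cos L < Real.cos θ then 1 else s

/-- The point `e^{iθ}` of the closed unit disc. -/
noncomputable def discExp (θ : ℝ) : Metric.closedBall (0 : ℂ) 1 :=
  ⟨Complex.exp (θ * Complex.I), by simp [Complex.norm_exp_ofReal_mul_I]⟩

lemma continuous_discExp : Continuous discExp := by
  unfold discExp
  fun_prop

/-- The averages of `h` over the points `v n` tend to its mean over the unit circle. -/
def AveragesToCircleMean (v : ∀ n : ℕ, Fin n → Metric.closedBall (0 : ℂ) 1)
    (h : C(Metric.closedBall (0 : ℂ) 1, ℂ)) : Prop :=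
  Tendsto (fun n : ℕ => (∑ i, h (v n i)) / (n : ℂ)) atTop
    (nhds ((1 / (2 * (π : ℂ))) * ∫ θ in (-π)..π, h (discExp θ)))

section Averages

variable {v : ∀ n : ℕ, Fin n → Metric.closedBall (0 : ℂ) 1}
  {h h₁ h₂ : C(Metric.closedBall (0 : ℂ) 1, ℂ)}

lemma intervalIntegrable_comp_discExp (h : C(Metric.closedBall (0 : ℂ) 1, ℂ)) (a b : ℝ) :
    IntervalIntegrable (fun θ => h (discExp θ)) volume a b :=
  (h.continuous.comp continuous_discExp).intervalIntegrable a b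

lemma AveragesToCircleMean.add (H₁ : AveragesToCircleMean v h₁)
    (H₂ : AveragesToCircleMean v h₂) : AveragesToCircleMean v (h₁ + h₂) := by
  unfold AveragesToCircleMean at *
  convert Tendsto.add H₁ H₂ using 2 with n
  · simp [Finset.sum_add_distrib, add_div]
  · simp only [ContinuousMap.add_apply]
    rw [intervalIntegral.integral_add (intervalIntegrable_comp_discExp _ _ _)
      (intervalIntegrable_comp_discExp _ _ _), mul_add]

lemma AveragesToCircleMean.const_mul (r : ℂ) (H : AveragesToCircleMean v h) :
    AveragesToCircleMean v (.const _ r * h) := by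
  unfold AveragesToCircleMean at *
  convert Tendsto.const_mul r H using 2 with n
  · simp [← Finset.mul_sum, mul_div_assoc]
  · simp; ring

/-- The condition of having convergent averages is closed under uniform limits. -/
lemma AveragesToCircleMean.of_approx
    (H : ∀ ε > 0, ∃ h', dist h h' ≤ ε ∧ AveragesToCircleMean v h') :
    AveragesToCircleMean v h := by
  unfold AveragesToCircleMean at *
  rw [Metric.tendsto_atTop]
  intro ε hε
  obtain ⟨h', hd, H'⟩ := H (ε / 4) (by positivity)
  rw [Metric.tendsto_atTop] at H'
  obtain ⟨N, hN⟩ := H' (ε / 4) (by positivity)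
  refine ⟨N, fun n hn => ?_⟩
  have hpt : ∀ x, ‖h x - h' x‖ ≤ ε / 4 := fun x => by
    rw [← dist_eq_norm]; exact (ContinuousMap.dist_apply_le_dist x).trans hd
  have e1 : ‖(∑ i, h (v n i)) / (n : ℂ) - (∑ i, h' (v n i)) / (n : ℂ)‖ ≤ ε / 4 := by
    rw [← sub_div, ← Finset.sum_sub_distrib, norm_div, Complex.norm_natCast]
    refine div_le_of_le_mul₀ (by positivity) (by positivity) ?_
    refine (norm_sum_le _ _).trans ((Finset.sum_le_sum fun i _ => hpt (v n i)).trans ?_)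
    simp [mul_comm]
  have e2 : ‖(1 / (2 * (π : ℂ))) * (∫ θ in (-π)..π, h (discExp θ)) -
      (1 / (2 * (π : ℂ))) * ∫ θ in (-π)..π, h' (discExp θ)‖ ≤ ε / 4 := by
    rw [← mul_sub, ← intervalIntegral.integral_sub (intervalIntegrable_comp_discExp _ _ _)
      (intervalIntegrable_comp_discExp _ _ _), norm_mul]
    have := intervalIntegral.norm_integral_le_of_norm_le_const (a := -π) (b := π)
      (f := fun θ => h (discExp θ) - h' (discExp θ)) (C := ε / 4) (fun θ _ => hpt _)
    have hp := Real.pi_pos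
    have e3 : ‖(1 / (2 * (π : ℂ)))‖ = 1 / (2 * π) := by
      simp [abs_of_pos hp]
    rw [e3]
    calc _ ≤ 1 / (2 * π) * (ε / 4 * |π - -π|) := by gcongr
      _ = ε / 4 := by
        rw [abs_of_pos (by linarith)]; field_simp; ring
  have e0 := hN n hn
  rw [dist_eq_norm] at e0 ⊢
  have := norm_sub_le_norm_sub_add_norm_sub ((∑ i, h (v n i)) / (n : ℂ))
    ((∑ i, h' (v n i)) / (n : ℂ)) ((1 / (2 * (π : ℂ))) * ∫ θ in (-π)..π, h (discExp θ))
  have := norm_sub_le_norm_sub_add_norm_sub ((∑ i, h' (v n i)) / (n : ℂ))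
    ((1 / (2 * (π : ℂ))) * ∫ θ in (-π)..π, h' (discExp θ))
    ((1 / (2 * (π : ℂ))) * ∫ θ in (-π)..π, h (discExp θ))
  rw [norm_sub_rev (1 / (2 * (π : ℂ)) * ∫ θ in (-π)..π, h' (discExp θ))] at this
  linarith

/-- The identity function of the closed unit disc. -/
noncomputable abbrev discId : C(Metric.closedBall (0 : ℂ) 1, ℂ) :=
  .restrict (Metric.closedBall (0 : ℂ) 1) (.id ℂ)

lemma averagesToCircleMean_of_monomials
    (H : ∀ a b : ℕ, AveragesToCircleMean v (discId ^ a * star discId ^ b))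
    (h : C(Metric.closedBall (0 : ℂ) 1, ℂ)) : AveragesToCircleMean v h := by
  let T : C(Metric.closedBall (0 : ℂ) 1, ℂ) → Prop := fun h =>
    ∀ a b : ℕ, AveragesToCircleMean v (discId ^ a * star discId ^ b * h)
  have T1 : T 1 := fun a b => by simpa using H a b
  suffices hT : ∀ h', T h' → T (h * h') by
    simpa using hT 1 T1 0 0
  refine ContinuousMap.induction_on (p := fun h => ∀ h', T h' → T (h * h'))
    ?_ ?_ ?_ ?_ ?_ ?_ h
  · intro r h' hh a b
    rw [mul_left_comm]
    exact (hh a b).const_mul r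
  · intro h' hh a b
    have := hh (a + 1) b
    rwa [pow_succ, mul_assoc (discId ^ a), mul_comm discId, ← mul_assoc, mul_assoc _ discId] at this
  · intro h' hh a b
    have := hh a (b + 1)
    rwa [pow_succ, ← mul_assoc, mul_assoc _ (star discId) h'] at this
  · intro f g hf hg h' hh a b
    rw [add_mul, mul_add]
    exact (hf h' hh a b).add (hg h' hh a b)
  · intro f g hf hg h' hh
    rw [mul_assoc]
    exact hf _ (hg _ hh)
  · intro hcl f h' hh a b
    refine AveragesToCircleMean.of_approx fun ε hε => ?_
    have hf : f ∈ closure ((polynomialFunctions (Metric.closedBall (0 : ℂ) 1)).starClosure :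
        Set C(Metric.closedBall (0 : ℂ) 1, ℂ)) := by
      rw [← StarSubalgebra.topologicalClosure_coe,
        polynomialFunctions.starClosure_topologicalClosure]
      trivial
    set m := discId ^ a * star discId ^ b
    obtain ⟨g, hg, hfg⟩ := Metric.mem_closure_iff.1 hf (ε / (‖m‖ * ‖h'‖ + 1)) (by positivity)
    refine ⟨m * (g * h'), ?_, hcl g hg h' hh a b⟩
    rw [dist_eq_norm] at hfg ⊢
    rw [← mul_sub, ← sub_mul]
    calc ‖m * ((f - g) * h')‖ ≤ ‖m‖ * (‖f - g‖ * ‖h'‖) :=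
          (norm_mul_le _ _).trans (by gcongr; exact norm_mul_le _ _)
      _ = (‖m‖ * ‖h'‖) * ‖f - g‖ := by ring
      _ ≤ (‖m‖ * ‖h'‖ + 1) * (ε / (‖m‖ * ‖h'‖ + 1)) := by gcongr; linarith
      _ = ε := by field_simp

lemma norm_discId_pow_mul_star_pow_sub_le (z : Metric.closedBall (0 : ℂ) 1) (a b : ℕ) :
    ‖(z : ℂ) ^ (a + b) * star (z : ℂ) ^ b - (z : ℂ) ^ a‖ ≤ 2 * b * (1 - ‖(z : ℂ)‖) := by
  have hz : ‖(z : ℂ)‖ ≤ 1 := mem_closedBall_zero_iff.1 z.2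
  have e : (z : ℂ) ^ (a + b) * star (z : ℂ) ^ b - (z : ℂ) ^ a
      = (z : ℂ) ^ a * (((‖(z : ℂ)‖ ^ (2 * b) - 1 : ℝ)) : ℂ) := by
    rw [pow_add, mul_assoc, ← mul_pow]
    have : (z : ℂ) * star (z : ℂ) = ((‖(z : ℂ)‖ ^ 2 : ℝ) : ℂ) := by
      rw [← Complex.normSq_eq_norm_sq]; exact Complex.mul_conj _
    rw [this]; push_cast; ring
  rw [e, norm_mul, Complex.norm_real, norm_pow, Real.norm_eq_abs]
  have b1 : 1 + ((2 * b : ℕ) : ℝ) * (‖(z : ℂ)‖ - 1) ≤ ‖(z : ℂ)‖ ^ (2 * b) := by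
    have := one_add_mul_le_pow (a := ‖(z : ℂ)‖ - 1) (by linarith [norm_nonneg (z : ℂ)]) (2 * b)
    simpa using this
  have b2 : ‖(z : ℂ)‖ ^ (2 * b) ≤ 1 := pow_le_one₀ (norm_nonneg _) hz
  have b3 : ‖(z : ℂ)‖ ^ a ≤ 1 := pow_le_one₀ (norm_nonneg _) hz
  push_cast at b1
  calc _ ≤ 1 * |‖(z : ℂ)‖ ^ (2 * b) - 1| := by gcongr
    _ ≤ _ := by rw [one_mul, abs_of_nonpos (by linarith)]; linarith

lemma integral_exp_neg_pi_pi (m : ℤ) :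
    ∫ θ in (-π)..π, Complex.exp (m * θ * Complex.I) = if m = 0 then 2 * (π : ℂ) else 0 := by
  split_ifs with hm
  · subst hm
    simp
    ring
  · have hm' : (m : ℂ) * Complex.I ≠ 0 := mul_ne_zero (by exact_mod_cast hm) Complex.I_ne_zero
    simp_rw [mul_right_comm (m : ℂ) _ Complex.I]
    rw [integral_exp_mul_complex hm', sub_eq_zero.2, zero_div]
    rw [Complex.exp_eq_exp_iff_exists_int]
    exact ⟨m, by push_cast; ring⟩

lemma integral_exp_pow_mul_star_pow (a b : ℕ) :
    (1 / (2 * (π : ℂ))) * ∫ θ in (-π)..π, Complex.exp (θ * Complex.I) ^ a *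
      star (Complex.exp (θ * Complex.I)) ^ b = if a = b then 1 else 0 := by
  have e : ∀ θ : ℝ, Complex.exp (θ * Complex.I) ^ a * star (Complex.exp (θ * Complex.I)) ^ b
      = Complex.exp (((a : ℤ) - b : ℤ) * θ * Complex.I) := fun θ => by
    have : star (Complex.exp (θ * Complex.I)) = Complex.exp (-(θ * Complex.I)) := by
      change (starRingEnd ℂ) _ = _
      rw [← Complex.exp_conj]; simp
    rw [this, ← Complex.exp_nat_mul, ← Complex.exp_nat_mul, ← Complex.exp_add]
    push_cast; ring_nf
  have hp : (π : ℂ) ≠ 0 := by exact_mod_cast Real.pi_ne_zero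
  simp_rw [e]
  rw [integral_exp_neg_pi_pi]
  simp only [sub_eq_zero, Nat.cast_inj]
  split_ifs
  · field_simp
  · simp

lemma averagesToCircleMean_of_powerSums
    (hnorm : Tendsto (fun n : ℕ => (∑ i, (1 - ‖(v n i : ℂ)‖)) / (n : ℝ)) atTop (nhds 0))
    (hpow : ∀ k : ℕ, 0 < k → Tendsto (fun n : ℕ => (∑ i, (v n i : ℂ) ^ k) / (n : ℂ)) atTop (nhds 0))
    (h : C(Metric.closedBall (0 : ℂ) 1, ℂ)) : AveragesToCircleMean v h := by
  have hpow' : ∀ k : ℕ, Tendsto (fun n : ℕ => (∑ i, (v n i : ℂ) ^ k) / (n : ℂ)) atTop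
      (nhds (if k = 0 then 1 else 0)) := by
    intro k
    rcases Nat.eq_zero_or_pos k with rfl | hk
    · refine Tendsto.congr' ?_ tendsto_const_nhds
      filter_upwards [eventually_gt_atTop 0] with n hn
      have : (n : ℂ) ≠ 0 := by exact_mod_cast hn.ne'
      simp [this]
    · rw [if_neg hk.ne']; exact hpow k hk
  have key : ∀ a b : ℕ, Tendsto (fun n : ℕ => (∑ i, (v n i : ℂ) ^ (a + b) *
      star (v n i : ℂ) ^ b) / (n : ℂ)) atTop (nhds (if a = 0 then 1 else 0)) := by
    intro a b
    have hdiff : Tendsto (fun n : ℕ => (∑ i, (v n i : ℂ) ^ (a + b) * star (v n i : ℂ) ^ b) / (n : ℂ)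
        - (∑ i, (v n i : ℂ) ^ a) / (n : ℂ)) atTop (nhds 0) := by
      refine squeeze_zero_norm (a := fun n : ℕ => 2 * b * ((∑ i, (1 - ‖(v n i : ℂ)‖)) / (n : ℝ)))
        (fun n => ?_) (by simpa using hnorm.const_mul (2 * b : ℝ))
      rw [← sub_div, ← Finset.sum_sub_distrib, norm_div, Complex.norm_natCast, ← mul_div_assoc,
        Finset.mul_sum]
      gcongr
      exact (norm_sum_le _ _).trans
        (Finset.sum_le_sum fun i _ => norm_discId_pow_mul_star_pow_sub_le _ _ _)
    simpa using hdiff.add (hpow' a)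
  refine averagesToCircleMean_of_monomials (fun a b => ?_) h
  unfold AveragesToCircleMean
  have hI : (1 / (2 * (π : ℂ))) * ∫ θ in (-π)..π, (discId ^ a * star discId ^ b) (discExp θ)
      = if a = b then 1 else 0 := integral_exp_pow_mul_star_pow a b
  rw [hI]
  change Tendsto (fun n : ℕ => (∑ i, (v n i : ℂ) ^ a * star (v n i : ℂ) ^ b) / (n : ℂ)) atTop _
  rcases le_total b a with hab | hab
  · obtain ⟨d, rfl⟩ := Nat.exists_eq_add_of_le' hab
    simpa using key d b
  · obtain ⟨d, rfl⟩ := Nat.exists_eq_add_of_le' hab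
    have := (Complex.continuous_conj.tendsto _).comp (key d a)
    convert this using 2 with n
    · simp [mul_comm]
    · by_cases hd : d = 0 <;> simp [hd]

/-- Equidistribution on the circle for points of the closed disc. -/
theorem tendsto_average_of_powerSums (w : ∀ n : ℕ, Fin n → ℂ) (hw : ∀ n i, ‖w n i‖ ≤ 1)
    (hnorm : Tendsto (fun n : ℕ => (∑ i, (1 - ‖w n i‖)) / (n : ℝ)) atTop (nhds 0))
    (hpow : ∀ k : ℕ, 0 < k → Tendsto (fun n : ℕ => (∑ i, w n i ^ k) / (n : ℂ)) atTop (nhds 0))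
    (g : ℂ → ℝ) (hg : Continuous g) :
    Tendsto (fun n : ℕ => (∑ i, g (w n i)) / (n : ℝ)) atTop
      (nhds ((1 / (2 * π)) * ∫ θ in (-π)..π, g (Complex.exp (θ * Complex.I)))) := by
  have := averagesToCircleMean_of_powerSums
    (v := fun n i => ⟨w n i, by simpa using hw n i⟩) hnorm hpow
    ⟨fun z => ((g z : ℝ) : ℂ), by fun_prop⟩
  have := (Complex.continuous_re.tendsto _).comp this
  convert this using 2 with n
  · simp only [ContinuousMap.coe_mk, Function.comp]
    rw [← Complex.ofReal_sum, ← Complex.ofReal_natCast, ← Complex.ofReal_div, Complex.ofReal_re]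
  · simp only [ContinuousMap.coe_mk, discExp]
    rw [intervalIntegral.integral_ofReal]
    norm_cast

end Averages

open Polynomial in
/-- The Toeplitz bilinear form `(X ^ i, X ^ j) ↦ c (i - j)` on polynomials. -/
noncomputable def toeplitzForm (c : ℤ → ℝ) : ℝ[X] →ₗ[ℝ] ℝ[X] →ₗ[ℝ] ℝ :=
  lsum fun i => LinearMap.smulRight LinearMap.id
    (lsum fun j => c ((i : ℤ) - j) • LinearMap.id)

section Toeplitz

open Polynomial

variable {c : ℤ → ℝ}

@[simp]
lemma toeplitzForm_monomial (i j : ℕ) (a b : ℝ) :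
    toeplitzForm c (monomial i a) (monomial j b) = a * b * c ((i : ℤ) - j) := by
  simp [toeplitzForm, lsum, sum_monomial_index]
  ring

lemma toeplitzForm_X_pow (i j : ℕ) :
    toeplitzForm c (X ^ i) (X ^ j) = c ((i : ℤ) - j) := by
  simp [X_pow_eq_monomial]

lemma toeplitzForm_comm (hc : ∀ k, c (-k) = c k) (P Q : ℝ[X]) :
    toeplitzForm c P Q = toeplitzForm c Q P := by
  induction P using Polynomial.induction_on' with
  | add p q hp hq => simp [hp, hq]
  | monomial i a =>
    induction Q using Polynomial.induction_on' with
    | add p q hp hq => simp [hp, hq]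
    | monomial j b =>
      rw [toeplitzForm_monomial, toeplitzForm_monomial, ← hc, neg_sub]; ring

lemma toeplitzForm_X_mul_X_mul (P Q : ℝ[X]) :
    toeplitzForm c (X * P) (X * Q) = toeplitzForm c P Q := by
  induction P using Polynomial.induction_on' with
  | add p q hp hq => simp [mul_add, hp, hq]
  | monomial i a =>
    induction Q using Polynomial.induction_on' with
    | add p q hp hq => rw [mul_add, map_add, map_add, hp, hq]
    | monomial j b => simp [X_mul_monomial]

lemma toeplitzForm_right_eq_sum (P : ℝ[X]) {Q : ℝ[X]} {m : ℕ} (hQ : Q.natDegree < m) :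
    toeplitzForm c P Q = ∑ j ∈ Finset.range m, Q.coeff j * toeplitzForm c P (X ^ j) := by
  conv_lhs => rw [Q.as_sum_range' m hQ]
  simp [← smul_X_eq_monomial]

lemma coeff_reflect_of_le (P : ℝ[X]) {n k : ℕ} (hk : k ≤ n) :
    (reflect n P).coeff k = P.coeff (n - k) := by
  rw [coeff_reflect, revAt_le hk]

lemma toeplitzForm_reflect (hc : ∀ k, c (-k) = c k) {P : ℝ[X]} {n k : ℕ} (hP : P.natDegree ≤ n)
    (hk : k ≤ n) :
    toeplitzForm c (reflect n P) (X ^ k) = toeplitzForm c P (X ^ (n - k)) := by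
  refine induction_with_natDegree_le
    (fun P => toeplitzForm c (reflect n P) (X ^ k) = toeplitzForm c P (X ^ (n - k))) n
    (by simp) (fun i a _ hi => ?_) (fun p q _ _ hp hq => by simp [hp, hq]) P hP
  rw [reflect_C_mul_X_pow, revAt_le hi, ← smul_eq_C_mul, ← smul_eq_C_mul, map_smul, map_smul]
  simp only [LinearMap.smul_apply, toeplitzForm_X_pow]
  rw [← hc]
  congr 2
  push_cast [hi, hk]
  ring

/-- Integration by parts for a sequence of moments with `k c k` proportional to `sin (k L)`. -/
lemma toeplitzForm_integration_by_parts {γ : ℝ}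
    (hrec : ∀ k : ℤ, (k + 1) * c (k + 1) + (k - 1) * c (k - 1) = 2 * γ * (k * c k)) (P Q : ℝ[X]) :
    toeplitzForm c (X * (X * derivative P)) Q + toeplitzForm c (X * derivative P) (X * Q)
      - 2 * γ * toeplitzForm c (X * derivative P) Q
      - toeplitzForm c (X * P) (X * derivative Q) - toeplitzForm c P (X * (X * derivative Q))
      + 2 * γ * toeplitzForm c P (X * derivative Q)
      + toeplitzForm c (X * P) Q - toeplitzForm c P (X * Q) = 0 := by
  have hX : ∀ (i : ℕ) (a : ℝ), X * derivative (monomial i a) = monomial i (i * a) := by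
    intro i a
    cases i with
    | zero => simp
    | succ i => simp [X_mul_monomial, mul_comm]
  induction P using Polynomial.induction_on' with
  | add p q hp hq => simp only [mul_add, map_add, LinearMap.add_apply]; linarith
  | monomial i a =>
    induction Q using Polynomial.induction_on' with
    | add p q hp hq => simp only [mul_add, map_add]; linarith
    | monomial j b =>
      simp only [hX, X_mul_monomial, toeplitzForm_monomial]
      have := hrec ((i : ℤ) - j)
      push_cast
      have e1 : (i : ℤ) + 1 - j = i - j + 1 := by ring
      have e2 : (i : ℤ) - (j + 1) = i - j - 1 := by ring
      rw [e1, e2]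
      push_cast at this
      linear_combination a * b * this

end Toeplitz

/-- A sequence of real monic polynomials orthogonal for a positive definite Toeplitz form. -/
structure IsToeplitzOrthogonal (c : ℤ → ℝ) (φ : ℕ → Polynomial ℝ) : Prop where
  even : ∀ k, c (-k) = c k
  pos : ∀ P, P ≠ 0 → 0 < toeplitzForm c P P
  monic : ∀ n, (φ n).Monic
  natDegree : ∀ n, (φ n).natDegree = n
  orth : ∀ n, ∀ k < n, toeplitzForm c (φ n) (Polynomial.X ^ k) = 0

namespace IsToeplitzOrthogonal

open Polynomial

variable {c : ℤ → ℝ} {φ : ℕ → ℝ[X]}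

lemma coeff_self (H : IsToeplitzOrthogonal c φ) (n : ℕ) : (φ n).coeff n = 1 := by
  have := H.monic n
  rwa [Monic, leadingCoeff, H.natDegree] at this

lemma apply_of_natDegree_le (H : IsToeplitzOrthogonal c φ)
    {n : ℕ} {Q : ℝ[X]} (hQ : Q.natDegree ≤ n + 1) :
    toeplitzForm c (φ n) Q = Q.coeff n * toeplitzForm c (φ n) (X ^ n) +
      Q.coeff (n + 1) * toeplitzForm c (φ n) (X ^ (n + 1)) := by
  rw [toeplitzForm_right_eq_sum _ (Nat.lt_succ_of_le hQ), Finset.sum_range_succ,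
    Finset.sum_range_succ, Finset.sum_eq_zero, zero_add]
  intro j hj
  rw [H.orth n j (Finset.mem_range.1 hj), mul_zero]

lemma reflect_orth (H : IsToeplitzOrthogonal c φ) {n k : ℕ} (hk : 0 < k) (hkn : k ≤ n) :
    toeplitzForm c (reflect n (φ n)) (X ^ k) = 0 := by
  rw [toeplitzForm_reflect H.even (H.natDegree n).le hkn]
  exact H.orth n _ (by omega)

lemma reflect_one (H : IsToeplitzOrthogonal c φ) (n : ℕ) :
    toeplitzForm c (reflect n (φ n)) 1 = toeplitzForm c (φ n) (X ^ n) := by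
  simpa using toeplitzForm_reflect H.even (H.natDegree n).le (Nat.zero_le n)

lemma reflect_apply_of_natDegree_le (H : IsToeplitzOrthogonal c φ)
    {n : ℕ} {Q : ℝ[X]} (hQ : Q.natDegree ≤ n + 1) :
    toeplitzForm c (reflect n (φ n)) Q = Q.coeff 0 * toeplitzForm c (φ n) (X ^ n) +
      Q.coeff (n + 1) * toeplitzForm c (reflect n (φ n)) (X ^ (n + 1)) := by
  rw [toeplitzForm_right_eq_sum _ (Nat.lt_succ_of_le hQ), Finset.sum_range_succ,
    Finset.sum_range_succ', Finset.sum_eq_zero, zero_add, pow_zero, H.reflect_one]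
  intro j hj
  rw [H.reflect_orth (Nat.succ_pos j) (Finset.mem_range.1 hj), mul_zero]

lemma natDegree_reflect_le (H : IsToeplitzOrthogonal c φ)
    (n : ℕ) : (reflect n (φ n)).natDegree ≤ n := by
  rw [natDegree_le_iff_coeff_eq_zero]
  intro m hm
  rw [coeff_reflect, revAt_eq_self_of_lt hm]
  exact coeff_eq_zero_of_natDegree_lt (by rw [H.natDegree]; exact hm)

/-- The Szegő recurrence. -/
lemma szego (H : IsToeplitzOrthogonal c φ) (n : ℕ) :
    φ (n + 1) = X * φ n + C ((φ (n + 1)).coeff 0) * reflect n (φ n) := by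
  set r := (φ (n + 1)).coeff 0
  set D := φ (n + 1) - X * φ n - C r * reflect n (φ n) with hD
  have h0 : D.coeff 0 = 0 := by
    rw [hD, coeff_sub, coeff_sub, coeff_C_mul, coeff_reflect_of_le _ (Nat.zero_le n), Nat.sub_zero,
      H.coeff_self, mul_coeff_zero, coeff_X_zero]
    ring
  have hdeg : D.natDegree ≤ n := by
    rw [natDegree_le_iff_coeff_eq_zero]
    intro m hm
    obtain ⟨m, rfl⟩ := Nat.exists_eq_add_of_lt hm
    rw [hD, coeff_sub, coeff_sub, coeff_C_mul,
      coeff_eq_zero_of_natDegree_lt ((H.natDegree_reflect_le n).trans_lt hm), coeff_X_mul, mul_zero]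
    rcases Nat.eq_zero_or_pos m with rfl | hm'
    · simp [H.coeff_self]
    · rw [coeff_eq_zero_of_natDegree_lt, coeff_eq_zero_of_natDegree_lt]
      · ring
      · rw [H.natDegree]; omega
      · rw [H.natDegree]; omega
  have hq : X * D.divX = D := by
    have := D.X_mul_divX_add
    rwa [h0, C_0, add_zero] at this
  have horth : ∀ k < n, toeplitzForm c D.divX (X ^ k) = 0 := by
    intro k hk
    rw [← toeplitzForm_X_mul_X_mul, hq, hD]
    simp only [map_sub, LinearMap.sub_apply, toeplitzForm_X_mul_X_mul, H.orth n k hk]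
    rw [← smul_eq_C_mul, map_smul, LinearMap.smul_apply, ← pow_succ', H.orth _ _ (by omega),
      H.reflect_orth (Nat.succ_pos k) hk]
    simp
  have hdq : D.divX = 0 := by
    by_contra hne
    have hn : D.divX.natDegree < n := by
      rw [natDegree_divX_eq_natDegree_tsub_one]
      have : n ≠ 0 := by
        rintro rfl
        apply hne
        rw [eq_C_of_natDegree_le_zero hdeg, divX_C]
      omega
    have := H.pos _ hne
    rw [toeplitzForm_right_eq_sum _ hn, Finset.sum_eq_zero] at this
    · exact lt_irrefl _ this
    · intro j hj
      rw [horth j (Finset.mem_range.1 hj), mul_zero]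
  have : D = 0 := by rw [← hq, hdq, mul_zero]
  rw [hD] at this
  linear_combination this

lemma szego_coeff (H : IsToeplitzOrthogonal c φ)
    (n k : ℕ) (hk : k < n) : (φ (n + 1)).coeff (k + 1) =
    (φ n).coeff k + (φ (n + 1)).coeff 0 * (φ n).coeff (n - (k + 1)) := by
  conv_lhs => rw [H.szego n]
  rw [coeff_add, coeff_X_mul, coeff_C_mul, coeff_reflect_of_le _ hk]

/-- The Szegő recurrence for the reversed polynomials. -/
lemma szego_reflect (H : IsToeplitzOrthogonal c φ) (n : ℕ) :
    reflect (n + 1) (φ (n + 1)) = reflect n (φ n) + C ((φ (n + 1)).coeff 0) * (X * φ n) := by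
  ext k
  rw [coeff_add, coeff_C_mul]
  rcases lt_or_ge (n + 1) k with hk | hk
  · rw [coeff_eq_zero_of_natDegree_lt ((H.natDegree_reflect_le _).trans_lt hk),
      coeff_eq_zero_of_natDegree_lt ((H.natDegree_reflect_le _).trans_lt (by omega)),
      coeff_eq_zero_of_natDegree_lt (p := X * φ n)]
    · simp
    · rw [natDegree_X_mul (H.monic n).ne_zero, H.natDegree]; exact hk
  rw [coeff_reflect_of_le _ hk]
  rcases Nat.eq_zero_or_pos k with rfl | hk0
  · rw [coeff_reflect_of_le _ (Nat.zero_le n)]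
    simp [H.coeff_self]
  obtain ⟨k, rfl⟩ := Nat.exists_eq_add_of_lt hk0
  simp only [zero_add] at *
  rw [coeff_X_mul]
  rcases Nat.lt_or_ge k n with hkn | hkn
  · obtain ⟨d, rfl⟩ := Nat.exists_eq_add_of_lt hkn
    rw [coeff_reflect_of_le _ (by omega)]
    have e1 : k + d + 1 + 1 - (k + 1) = d + 1 := by omega
    have e2 : k + d + 1 - (k + 1) = d := by omega
    rw [e1, e2, H.szego_coeff _ _ (by omega)]
    congr 3; omega
  · have : k = n := by omega
    subst this
    rw [coeff_eq_zero_of_natDegree_lt ((H.natDegree_reflect_le _).trans_lt (by omega)),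
      H.coeff_self]
    simp

lemma form_reflect_X_pow_succ (H : IsToeplitzOrthogonal c φ) (n : ℕ) :
    toeplitzForm c (reflect n (φ n)) (X ^ (n + 1)) =
      -(φ (n + 1)).coeff 0 * toeplitzForm c (φ n) (X ^ n) := by
  have := H.reflect_orth (Nat.succ_pos n) le_rfl
  rw [H.szego_reflect, ← smul_eq_C_mul, map_add, map_smul, LinearMap.add_apply,
    LinearMap.smul_apply, pow_succ', toeplitzForm_X_mul_X_mul, smul_eq_mul, ← pow_succ'] at this
  linarith

lemma form_X_pow_succ (H : IsToeplitzOrthogonal c φ) (n : ℕ) :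
    toeplitzForm c (φ n) (X ^ (n + 1)) =
      -(φ (n + 1)).coeff n * toeplitzForm c (φ n) (X ^ n) := by
  have h1 := H.apply_of_natDegree_le (n := n) (H.natDegree (n + 1)).le
  have h2 : toeplitzForm c (φ n) (φ (n + 1)) = 0 := by
    rw [toeplitzForm_comm H.even, toeplitzForm_right_eq_sum (m := n + 1) _
      (by rw [H.natDegree]; omega), Finset.sum_eq_zero]
    intro j hj
    rw [H.orth _ j (Finset.mem_range.1 hj), mul_zero]
  rw [H.coeff_self] at h1
  linarith

lemma form_self (H : IsToeplitzOrthogonal c φ)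
    (n : ℕ) : toeplitzForm c (φ n) (φ n) = toeplitzForm c (φ n) (X ^ n) := by
  have := H.apply_of_natDegree_le (n := n) (Q := φ n) (by rw [H.natDegree]; omega)
  rw [H.coeff_self, coeff_eq_zero_of_natDegree_lt (n := n + 1) (by rw [H.natDegree]; omega)] at this
  linarith

lemma form_pos (H : IsToeplitzOrthogonal c φ) (n : ℕ) : 0 < toeplitzForm c (φ n) (X ^ n) := by
  rw [← H.form_self]; exact H.pos _ (H.monic n).ne_zero

lemma form_succ (H : IsToeplitzOrthogonal c φ) (n : ℕ) : toeplitzForm c (φ (n + 1)) (X ^ (n + 1)) =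
    toeplitzForm c (φ n) (X ^ n) * (1 - (φ (n + 1)).coeff 0 ^ 2) := by
  conv_lhs => rw [H.szego n]
  rw [map_add, LinearMap.add_apply, ← smul_eq_C_mul, map_smul, LinearMap.smul_apply,
    H.form_reflect_X_pow_succ, pow_succ', toeplitzForm_X_mul_X_mul, smul_eq_mul]
  ring

lemma coeff_zero_sq_lt_one (H : IsToeplitzOrthogonal c φ)
    (n : ℕ) : (φ (n + 1)).coeff 0 ^ 2 < 1 := by
  have h1 := H.form_pos n
  have h2 := H.form_pos (n + 1)
  rw [H.form_succ] at h2
  have := pos_of_mul_pos_right h2 h1.le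
  linarith

/-- The second order recurrence satisfied by the reflection coefficients. -/
lemma reflection_recurrence (H : IsToeplitzOrthogonal c φ) {γ : ℝ}
    (hrec : ∀ k : ℤ, (k + 1) * c (k + 1) + (k - 1) * c (k - 1) = 2 * γ * (k * c k)) (n : ℕ) :
    (1 - (φ (n + 1)).coeff 0 ^ 2) * ((n + 2) * (φ (n + 2)).coeff 0 + n * (φ n).coeff 0) =
      2 * (φ (n + 1)).coeff 0 * (γ * (n + 1) + (φ (n + 1)).coeff n) := by
  have ibp := toeplitzForm_integration_by_parts hrec (φ (n + 1)) (reflect (n + 1) (φ (n + 1)))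
  have hd := H.natDegree (n + 1)
  have hr := H.natDegree_reflect_le (n + 1)
  set p := φ (n + 1) with hp
  set q := reflect (n + 1) p with hq
  have hh := H.form_pos (n + 1)
  have hv := H.form_reflect_X_pow_succ (n + 1)
  have hu := H.form_X_pow_succ (n + 1)
  rw [← hp, ← hq] at hv
  rw [← hp] at hu hh
  set h := toeplitzForm c p (X ^ (n + 1))
  have hX : ∀ {P : ℝ[X]} {m : ℕ}, P.natDegree ≤ m → (X * P).natDegree ≤ m + 1 := fun {P m} hP =>
    natDegree_mul_le.trans (by rw [natDegree_X]; omega)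
  have hdp : (derivative p).natDegree ≤ n := (natDegree_derivative_le p).trans (by omega)
  have hdq : (derivative q).natDegree ≤ n := (natDegree_derivative_le q).trans (by omega)
  have A : ∀ {Q : ℝ[X]}, Q.natDegree ≤ n + 2 → toeplitzForm c p Q =
      Q.coeff (n + 1) * h + Q.coeff (n + 2) * toeplitzForm c p (X ^ (n + 2)) :=
    fun {Q} hQ => H.apply_of_natDegree_le hQ
  have B : ∀ {Q : ℝ[X]}, Q.natDegree ≤ n + 2 → toeplitzForm c Q q =
      Q.coeff 0 * h + Q.coeff (n + 2) * toeplitzForm c q (X ^ (n + 2)) := fun {Q} hQ => by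
    rw [toeplitzForm_comm H.even]; exact H.reflect_apply_of_natDegree_le hQ
  have q1 : q.coeff (n + 1) = p.coeff 0 := by
    rw [hq, hp, coeff_reflect_of_le _ le_rfl, Nat.sub_self]
  have q0 : q.coeff n = p.coeff 1 := by
    rw [hq, hp, coeff_reflect_of_le _ (by omega)]; congr 1; omega
  have p1 : p.coeff (n + 1) = 1 := H.coeff_self _
  have z1 : ∀ {P : ℝ[X]}, P.natDegree ≤ n → P.coeff (n + 1) = 0 := fun hP =>
    coeff_eq_zero_of_natDegree_lt (Nat.lt_succ_of_le hP)
  have z2 : ∀ {P : ℝ[X]}, P.natDegree ≤ n → P.coeff (n + 2) = 0 := fun hP =>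
    coeff_eq_zero_of_natDegree_lt (by omega)
  rw [toeplitzForm_X_mul_X_mul, toeplitzForm_X_mul_X_mul,
    B (hX (hX hdp)), B (hdp.trans (by omega)), B ((hX hdp).trans (by omega)), B (hX hd.le),
    A (hdq.trans (by omega)), A (hX (hX hdq)), A ((hX hdq).trans (by omega)), A (hX hr), hv, hu,
    z1 hdq, z2 hdp, z2 hdq] at ibp
  simp only [coeff_X_mul, mul_coeff_zero, coeff_X_zero, coeff_derivative, q1, q0, p1, z1 hdp,
    z1 hdq] at ibp
  have l2 : (φ (n + 2)).coeff (n + 1) = (φ (n + 1)).coeff n +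
      (φ (n + 2)).coeff 0 * (φ (n + 1)).coeff 0 := by
    have := H.szego_coeff (n + 1) n (by omega)
    simpa using this
  have hk : (n : ℝ) * p.coeff 1 = n * ((φ n).coeff 0 +
      p.coeff 0 * (p.coeff n - p.coeff 0 * (φ n).coeff 0)) := by
    rcases Nat.eq_zero_or_pos n with rfl | hn
    · simp
    · obtain ⟨m, rfl⟩ := Nat.exists_eq_add_of_lt hn
      have k1 := H.szego_coeff (0 + m + 1) 0 (by omega)
      have k2 := H.szego_coeff (0 + m + 1) m (by omega)
      simp only [zero_add, Nat.add_sub_cancel, Nat.sub_self] at k1 k2 hp ⊢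
      rw [← hp] at k1 k2
      rw [k1, k2]
      ring
  rw [l2, ← hp] at ibp
  have hxd : (X * derivative q).coeff n = n * p.coeff 1 := by
    rw [← q0]
    cases n with
    | zero => simp
    | succ n => rw [coeff_X_mul, coeff_derivative]; push_cast; ring
  rw [hxd] at ibp
  push_cast at ibp
  have : h * ((1 - p.coeff 0 ^ 2) * ((n + 2) * (φ (n + 2)).coeff 0 + n * (φ n).coeff 0) -
      2 * p.coeff 0 * (γ * (n + 1) + p.coeff n)) = 0 := by
    linear_combination (-1) * ibp - h * hk
  rcases mul_eq_zero.1 this with h0 | h0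
  · exact absurd h0 hh.ne'
  · linarith

end IsToeplitzOrthogonal

/-- A second order linear recurrence with elliptic limiting coefficients has no exponentially
decaying solution. -/
lemma exists_mul_pow_le_of_recurrence {x g : ℕ → ℝ} {γ : ℝ} (hγ : |γ| < 1)
    (hg : Tendsto g atTop (nhds γ)) (hx : ∀ n, x (n + 2) = 2 * g n * x (n + 1) - x n)
    (hx1 : x 1 ≠ 0) {ρ : ℝ} (hρ : ρ ∈ Set.Ioo (0 : ℝ) 1) :
    ∃ C > 0, ∀ᶠ n in atTop, C * ρ ^ n ≤ x (n + 1) ^ 2 + x n ^ 2 := by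
  obtain ⟨hρ0, hρ1⟩ := hρ
  obtain ⟨hγ1, hγ2⟩ := abs_lt.1 hγ
  let F : ℕ → ℝ := fun n => x (n + 1) ^ 2 + x n ^ 2 - 2 * γ * (x (n + 1) * x n)
  have hxy : ∀ n, |2 * (x (n + 1) * x n)| ≤ x (n + 1) ^ 2 + x n ^ 2 := fun n =>
    abs_le.2 ⟨by nlinarith [sq_nonneg (x (n + 1) + x n)],
      by nlinarith [sq_nonneg (x (n + 1) - x n)]⟩
  have hγxy : ∀ n, |2 * γ * (x (n + 1) * x n)| ≤ |γ| * (x (n + 1) ^ 2 + x n ^ 2) := fun n => by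
    rw [show 2 * γ * (x (n + 1) * x n) = γ * (2 * (x (n + 1) * x n)) by ring, abs_mul]
    gcongr
    exact hxy n
  have hlow : ∀ n, (1 - |γ|) * (x (n + 1) ^ 2 + x n ^ 2) ≤ F n := fun n => by
    have := (abs_le.1 (hγxy n)).2
    simp only [F]; linarith
  have hup : ∀ n, F n ≤ 2 * (x (n + 1) ^ 2 + x n ^ 2) := fun n => by
    have h1 := (abs_le.1 (hγxy n)).1
    have h2 : |γ| * (x (n + 1) ^ 2 + x n ^ 2) ≤ 1 * (x (n + 1) ^ 2 + x n ^ 2) := by gcongr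
    simp only [F]; linarith
  have hne : ∀ n, 0 < x (n + 1) ^ 2 + x n ^ 2 := by
    intro n
    induction n with
    | zero => positivity
    | succ n ih =>
      by_contra hcon
      have h1 : x (n + 1) = 0 := by nlinarith [sq_nonneg (x (n + 1)), sq_nonneg (x (n + 2))]
      have h2 : x (n + 2) = 0 := by nlinarith [sq_nonneg (x (n + 1)), sq_nonneg (x (n + 2))]
      have h3 : x n = 0 := by have := hx n; rw [h1, h2] at this; linarith
      rw [h1, h3] at ih
      norm_num at ih
  have hstep : ∀ᶠ n in atTop, ρ * F n ≤ F (n + 1) := by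
    have hδ : 0 < (1 - ρ) * (1 - |γ|) / 12 := by
      have : 0 < 1 - ρ := by linarith
      have : 0 < 1 - |γ| := by linarith
      positivity
    filter_upwards [Metric.tendsto_nhds.1 hg _ (lt_min hδ one_pos)] with n hn
    rw [Real.dist_eq, lt_min_iff] at hn
    obtain ⟨hn1, hn2⟩ := hn
    have hg2 : |g n| ≤ 2 := by
      have := abs_sub_abs_le_abs_sub (g n) γ
      linarith
    set S := x (n + 1) ^ 2 + x n ^ 2
    have hS : 0 < S := hne n
    have e : F (n + 1) - F n = (g n - γ) * (4 * g n * x (n + 1) ^ 2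
        - 2 * (2 * (x (n + 1) * x n))) := by
      simp only [F, hx n]; ring
    have b1 : |4 * g n * x (n + 1) ^ 2 - 2 * (2 * (x (n + 1) * x n))| ≤ 12 * S := by
      refine (abs_sub _ _).trans ?_
      rw [abs_mul, abs_mul, abs_mul 2 (2 * _), abs_of_nonneg (sq_nonneg (x (n + 1))),
        abs_of_pos (by norm_num : (0 : ℝ) < 4), abs_of_pos (by norm_num : (0 : ℝ) < 2)]
      have h1 : 4 * |g n| * x (n + 1) ^ 2 ≤ 4 * 2 * x (n + 1) ^ 2 := by gcongr
      have h2 := hxy n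
      have h3 : x (n + 1) ^ 2 ≤ S := by simp only [S]; nlinarith [sq_nonneg (x n)]
      linarith
    have b2 : |F (n + 1) - F n| ≤ (1 - ρ) * (1 - |γ|) / 12 * (12 * S) := by
      rw [e, abs_mul]; gcongr
    have b3 := (abs_le.1 b2).1
    have b4 := mul_le_mul_of_nonneg_left (hlow n) (by linarith : 0 ≤ 1 - ρ)
    linarith
  obtain ⟨N, hN⟩ := eventually_atTop.1 hstep
  have hFN : 0 < F N := lt_of_lt_of_le (mul_pos (by linarith) (hne N)) (hlow N)
  have hgrow : ∀ m, ρ ^ m * F N ≤ F (N + m) := by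
    intro m
    induction m with
    | zero => simp
    | succ m ih =>
      calc ρ ^ (m + 1) * F N = ρ * (ρ ^ m * F N) := by ring
        _ ≤ ρ * F (N + m) := by gcongr
        _ ≤ F (N + m + 1) := hN _ (by omega)
  refine ⟨F N / 2, by positivity, eventually_atTop.2 ⟨N, fun n hn => ?_⟩⟩
  obtain ⟨m, rfl⟩ := Nat.exists_eq_add_of_le hn
  have h1 := hgrow m
  have h2 := hup (N + m)
  have h3 : ρ ^ (N + m) ≤ ρ ^ m := pow_le_pow_of_le_one hρ0.le hρ1.le (by omega)
  have h4 : ρ ^ (N + m) * F N ≤ ρ ^ m * F N := by gcongr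
  linarith

/-- Subexponential lower bounds on `y` and `y n ≲ n ^ 4 exp (-2 S n)` force `S n = o(n)`. -/
lemma tendsto_div_of_subexponential {S y : ℕ → ℝ} {K : ℝ} (hS : ∀ n, 0 ≤ S n)
    (hy : ∀ ρ ∈ Set.Ioo (0 : ℝ) 1, ∃ C > 0, ∀ᶠ n in atTop, C * ρ ^ n ≤ y n)
    (hyS : ∀ n, y n ≤ K * (n + 1 : ℝ) ^ 4 * Real.exp (-2 * S (n + 1))) :
    Tendsto (fun n : ℕ => S n / n) atTop (nhds 0) := by
  rw [← tendsto_add_atTop_iff_nat 1, Metric.tendsto_nhds]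
  intro ε hε
  obtain ⟨C, hC, hev⟩ := hy (Real.exp (-(ε / 2))) ⟨Real.exp_pos _, by
    rw [Real.exp_lt_one_iff]; linarith⟩
  have hlim : Tendsto (fun n : ℕ => K / C * ((n + 1 : ℝ) ^ 4 * Real.exp (-(ε / 2) * (n + 1)))) atTop
      (nhds 0) := by
    have ht : Tendsto (fun n : ℕ => ε / 2 * (n + 1 : ℝ)) atTop atTop :=
      (tendsto_atTop_add_const_right _ _ tendsto_natCast_atTop_atTop).const_mul_atTop
        (by positivity)
    have h1 := ((tendsto_pow_mul_exp_neg_atTop_nhds_zero 4).comp ht).const_mul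
      (K / C / (ε / 2) ^ 4)
    rw [mul_zero] at h1
    refine h1.congr fun n => ?_
    simp only [Function.comp, mul_pow, neg_mul]
    field_simp
  filter_upwards [hev, hlim.eventually_lt_const one_pos] with n h1 h2
  have h3 := h1.trans (hyS n)
  have hn : (0 : ℝ) < n + 1 := by positivity
  rw [Real.dist_eq, sub_zero, abs_of_nonneg (div_nonneg (hS _) (by positivity))]
  push_cast
  rw [div_lt_iff₀ hn]
  by_contra! hcon
  rw [← Real.exp_nat_mul] at h3
  have h4 : Real.exp (-2 * S (n + 1)) ≤ Real.exp (-2 * (ε * (n + 1))) :=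
    Real.exp_le_exp.2 (by linarith)
  set t : ℝ := (n : ℝ) + 1 with ht
  have h5 : Real.exp (-(ε / 2) * t) ≤ Real.exp (n * -(ε / 2)) :=
    Real.exp_le_exp.2 (by rw [ht]; nlinarith)
  have h6 : Real.exp (-2 * (ε * t)) ≤ Real.exp (-(ε / 2) * t) * Real.exp (-(ε / 2) * t) := by
    rw [← Real.exp_add]; exact Real.exp_le_exp.2 (by nlinarith)
  have hE := Real.exp_pos (-(ε / 2) * t)
  set E := Real.exp (-(ε / 2) * t)
  have hK : 0 < K * t ^ 4 := by
    by_contra! hK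
    have := mul_nonpos_of_nonpos_of_nonneg hK (Real.exp_pos (-2 * S (n + 1))).le
    have := mul_pos hC (Real.exp_pos (n * -(ε / 2)))
    linarith
  have h7 : C * E ≤ K * t ^ 4 * (E * E) :=
    calc C * E ≤ C * Real.exp (n * -(ε / 2)) := by gcongr
      _ ≤ _ := h3
      _ ≤ _ := by gcongr; exact h4.trans h6
  have h8 : K * t ^ 4 * E < C := by
    have : K / C * (t ^ 4 * E) = K * t ^ 4 * E / C := by ring
    rwa [this, div_lt_one hC] at h2
  have := mul_lt_mul_of_pos_right h8 hE
  linarith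

section Zeros

open Polynomial

/-- Newton's identities bound the power sums by the elementary symmetric functions. -/
lemma exists_powerSum_bound (w : ∀ n : ℕ, Fin n → ℂ) {K : ℝ}
    (hK : ∀ n j, ‖(Finset.univ.val.map (w n)).esymm j‖ ≤ K) (k : ℕ) (hk : 0 < k) :
    ∃ M, ∀ n, ‖∑ i, w n i ^ k‖ ≤ M := by
  have hK0 : 0 ≤ K := (norm_nonneg _).trans (hK 0 0)
  induction k using Nat.strong_induction_on with
  | _ k ih =>
    choose! M hM using ih
    refine ⟨k * K + ∑ a ∈ Finset.HasAntidiagonal.antidiagonal k with a.1 ∈ Set.Ioo 0 k, K * M a.2,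
      fun n => ?_⟩
    have hN := congrArg (MvPolynomial.aeval (w n))
      (MvPolynomial.psum_eq_mul_esymm_sub_sum (Fin n) ℂ k hk)
    simp only [MvPolynomial.psum, map_sum, map_pow, MvPolynomial.aeval_X, map_sub, map_mul,
      map_neg, map_one, map_natCast, MvPolynomial.aeval_esymm_eq_multiset_esymm] at hN
    rw [hN]
    refine (norm_sub_le _ _).trans (add_le_add ?_ ((norm_sum_le _ _).trans
      (Finset.sum_le_sum fun a ha => ?_)))
    · simp only [norm_mul, norm_pow, norm_neg, norm_one, one_pow, one_mul, Complex.norm_natCast]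
      gcongr
      exact hK n k
    · simp only [norm_mul, norm_pow, norm_neg, norm_one, one_pow, one_mul]
      rw [Finset.mem_filter, Finset.HasAntidiagonal.mem_antidiagonal, Set.mem_Ioo] at ha
      gcongr
      · exact hK n _
      · exact hM a.2 (by omega) (by omega) n

lemma norm_esymm_le_of_norm_coeff_le {n : ℕ} (w : Fin n → ℂ) {K : ℝ}
    (hK : ∀ j, ‖(∏ i, (X - C (w i))).coeff j‖ ≤ K) (j : ℕ) :
    ‖(Finset.univ.val.map w).esymm j‖ ≤ K := by
  rcases le_or_gt j n with hj | hj
  · have := Multiset.prod_X_sub_C_coeff (Finset.univ.val.map w) (k := n - j) (by simp)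
    have h2 := hK (n - j)
    rw [Multiset.map_map] at this
    change ‖(Multiset.map ((fun t => X - C t) ∘ w) Finset.univ.val).prod.coeff (n - j)‖ ≤ K at h2
    rw [this] at h2
    simpa [Nat.sub_sub_self hj] using h2
  · rw [Multiset.esymm, Multiset.powersetCard_eq_empty]
    · simpa using (norm_nonneg _).trans (hK 0)
    · simpa using hj

lemma prod_norm_le_exp {ι : Type*} (s : Finset ι) (w : ι → ℂ) :
    ∏ i ∈ s, ‖w i‖ ≤ Real.exp (-∑ i ∈ s, (1 - ‖w i‖)) := by
  rw [← Finset.sum_neg_distrib, Real.exp_sum]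
  refine Finset.prod_le_prod (fun i _ => norm_nonneg _) fun i _ => ?_
  have := Real.add_one_le_exp (-(1 - ‖w i‖))
  linarith

lemma norm_coeff_zero_prod_le {n : ℕ} (w : Fin n → ℂ) :
    ‖(∏ i, (X - C (w i))).coeff 0‖ ≤ Real.exp (-∑ i, (1 - ‖w i‖)) := by
  have : ‖(∏ i, (X - C (w i))).coeff 0‖ = ∏ i, ‖w i‖ := by
    rw [coeff_zero_eq_eval_zero, eval_prod, norm_prod]; simp
  rw [this]
  exact prod_norm_le_exp _ _

lemma norm_coeff_one_prod_le {n : ℕ} (w : Fin n → ℂ) :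
    ‖(∏ i, (X - C (w i))).coeff 1‖ ≤ n * Real.exp (1 - ∑ i, (1 - ‖w i‖)) := by
  have h1 : (∏ i, (X - C (w i))).coeff 1 = (derivative (∏ i, (X - C (w i)))).eval 0 := by
    rw [← coeff_zero_eq_eval_zero, coeff_derivative]; simp
  rw [h1, derivative_prod_finset, eval_finsetSum]
  refine (norm_sum_le _ _).trans ((Finset.sum_le_card_nsmul _ _ _ fun i _ => ?_).trans
    (le_of_eq (by rw [Finset.card_univ, Fintype.card_fin, nsmul_eq_mul])))
  rw [eval_mul, eval_prod, norm_mul, norm_prod]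
  simp only [eval_sub, eval_X, eval_C, zero_sub, norm_neg, derivative_X_sub_C, eval_one, norm_one,
    mul_one]
  refine (prod_norm_le_exp _ _).trans (Real.exp_le_exp.2 ?_)
  rw [← Finset.add_sum_erase _ _ (Finset.mem_univ i)]
  linarith [norm_nonneg (w i)]

lemma exists_fin_roots (p : ℂ[X]) (hp : p.Monic) {n : ℕ} (hn : p.natDegree = n) :
    ∃ w : Fin n → ℂ, p.roots = Finset.univ.val.map w ∧ p = ∏ i, (X - C (w i)) := by
  have hcard : p.roots.toList.length = n := by
    rw [Multiset.length_toList, ← hn]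
    exact (splits_iff_card_roots.1 (IsAlgClosed.splits p))
  subst hcard
  have hl : ∀ l : List ℂ, (l : Multiset ℂ) = Finset.univ.val.map l.get := fun l => by
    rw [Fin.univ_val_map, List.ofFn_get]
  have hr : p.roots = Finset.univ.val.map p.roots.toList.get := by
    rw [← hl, Multiset.coe_toList]
  refine ⟨p.roots.toList.get, hr, ?_⟩
  have h := (IsAlgClosed.splits p).eq_prod_roots_of_monic hp
  conv_lhs => rw [h, hr]
  rw [Multiset.map_map]
  rfl

end Zeros

namespace IsToeplitzOrthogonal

open Polynomial

variable {c : ℤ → ℝ} {φ : ℕ → ℝ[X]}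

lemma eq_one (H : IsToeplitzOrthogonal c φ) : φ 0 = 1 := by
  rw [eq_C_of_natDegree_eq_zero (H.natDegree 0), H.coeff_self, C_1]

lemma aeval_ne_zero_and_norm_reflect_le (H : IsToeplitzOrthogonal c φ)
    (n : ℕ) {z : ℂ} (hz : 1 ≤ ‖z‖) :
    aeval z (φ n) ≠ 0 ∧ ‖aeval z (reflect n (φ n))‖ ≤ ‖aeval z (φ n)‖ := by
  induction n with
  | zero => simp [H.eq_one]
  | succ n ih =>
    obtain ⟨hne, hle⟩ := ih
    have hr := H.coeff_zero_sq_lt_one n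
    have e1 := congrArg (aeval z) (H.szego n)
    have e2 := congrArg (aeval z) (H.szego_reflect n)
    simp only [map_add, map_mul, aeval_X, aeval_C, Complex.coe_algebraMap] at e1 e2
    set r := (φ (n + 1)).coeff 0
    set a := z * aeval z (φ n) with ha
    set b := aeval z (reflect n (φ n))
    have hab : ‖b‖ ≤ ‖a‖ := by
      rw [ha, norm_mul]
      exact hle.trans (le_mul_of_one_le_left (norm_nonneg _) hz)
    have ha0 : 0 < ‖a‖ := by
      rw [ha, norm_mul]
      exact mul_pos (by linarith) (norm_pos_iff.2 hne)
    have hr' : |r| < 1 := (sq_lt_one_iff_abs_lt_one r).1 hr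
    rw [e1, e2]
    constructor
    · intro h0
      have : ‖a‖ = |r| * ‖b‖ := by
        rw [eq_neg_of_add_eq_zero_left h0, norm_neg, norm_mul, Complex.norm_real, Real.norm_eq_abs]
      nlinarith [abs_nonneg r, norm_nonneg b]
    · rw [← sq_le_sq₀ (norm_nonneg _) (norm_nonneg _)]
      have id1 : ‖a + r * b‖ ^ 2 - ‖b + r * a‖ ^ 2 = (1 - r ^ 2) * (‖a‖ ^ 2 - ‖b‖ ^ 2) := by
        simp only [Complex.sq_norm, Complex.normSq_apply, Complex.add_re, Complex.add_im,
          Complex.mul_re, Complex.mul_im, Complex.ofReal_re, Complex.ofReal_im]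
        ring
      have : 0 ≤ (1 - r ^ 2) * (‖a‖ ^ 2 - ‖b‖ ^ 2) :=
        mul_nonneg (by linarith) (by nlinarith [norm_nonneg a, norm_nonneg b])
      linarith

variable {s : ℝ}

lemma coeff_sq_le (H : IsToeplitzOrthogonal c φ) (hs : 0 < s)
    (hlow : ∀ (P : ℝ[X]) (j : ℕ), s * P.coeff j ^ 2 ≤ toeplitzForm c P P)
    (n j : ℕ) : (φ n).coeff j ^ 2 ≤ c 0 / s := by
  have hanti : ∀ n, toeplitzForm c (φ n) (X ^ n) ≤ c 0 := by
    intro n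
    induction n with
    | zero =>
      have : toeplitzForm c (X ^ 0) (X ^ 0) = c 0 := by rw [toeplitzForm_X_pow]; simp
      rw [H.eq_one, ← this, pow_zero]
    | succ n ih =>
      rw [H.form_succ]
      nlinarith [H.form_pos n, sq_nonneg ((φ (n + 1)).coeff 0)]
  rw [le_div_iff₀ hs, mul_comm]
  exact (hlow _ _).trans ((H.form_self n).le.trans (hanti n))

lemma tendsto_coeff_zero (H : IsToeplitzOrthogonal c φ) (hs : 0 < s)
    (hlow : ∀ (P : ℝ[X]) (j : ℕ), s * P.coeff j ^ 2 ≤ toeplitzForm c P P) :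
    Tendsto (fun n => (φ (n + 1)).coeff 0 ^ 2) atTop (nhds 0) := by
  let h : ℕ → ℝ := fun n => toeplitzForm c (φ n) (X ^ n)
  have hs' : ∀ n, s ≤ h n := fun n => by
    have := hlow (φ n) n
    rw [H.coeff_self, H.form_self] at this
    simpa using this
  have hanti : Antitone h := antitone_nat_of_succ_le fun n => by
    have := H.form_succ n
    simp only [h]
    nlinarith [H.form_pos n, sq_nonneg ((φ (n + 1)).coeff 0)]
  have hlim := tendsto_atTop_ciInf hanti ⟨s, by rintro _ ⟨n, rfl⟩; exact hs' n⟩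
  have hd : Tendsto (fun n => (h n - h (n + 1)) / s) atTop (nhds 0) := by
    simpa using (hlim.sub (hlim.comp (tendsto_add_atTop_nat 1))).div_const s
  refine squeeze_zero (fun n => sq_nonneg _) (fun n => ?_) hd
  rw [le_div_iff₀ hs]
  have e : h n - h (n + 1) = h n * (φ (n + 1)).coeff 0 ^ 2 := by
    simp only [h, H.form_succ]; ring
  rw [e, mul_comm]
  gcongr
  exact hs' n

/-- The reflection coefficients do not decay exponentially. -/
lemma exists_mul_pow_le (H : IsToeplitzOrthogonal c φ) (hs : 0 < s)
    (hlow : ∀ (P : ℝ[X]) (j : ℕ), s * P.coeff j ^ 2 ≤ toeplitzForm c P P)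
    {γ : ℝ} (hγ : |γ| < 1)
    (hrec : ∀ k : ℤ, (k + 1) * c (k + 1) + (k - 1) * c (k - 1) = 2 * γ * (k * c k))
    (hc1 : c 1 ≠ 0) {ρ : ℝ} (hρ : ρ ∈ Set.Ioo (0 : ℝ) 1) :
    ∃ C > 0, ∀ᶠ n : ℕ in atTop, C * ρ ^ n ≤
      ((n + 1) * (φ (n + 1)).coeff 0) ^ 2 + (n * (φ n).coeff 0) ^ 2 := by
  have hlim := H.tendsto_coeff_zero hs hlow
  have hl : Tendsto (fun n : ℕ => (φ (n + 1)).coeff n / ((n : ℝ) + 1)) atTop (nhds 0) := by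
    refine squeeze_zero_norm (a := fun n : ℕ => (c 0 / s + 1) * (1 / ((n : ℝ) + 1)))
      (fun n => ?_) ?_
    · have := H.coeff_sq_le hs hlow (n + 1) n
      rw [norm_div, Real.norm_eq_abs, Real.norm_eq_abs, abs_of_pos (by positivity : (0:ℝ) < n + 1),
        mul_one_div]
      gcongr
      rw [← sq_abs] at this
      nlinarith [abs_nonneg ((φ (n + 1)).coeff n)]
    · simpa using tendsto_one_div_add_atTop_nhds_zero_nat.const_mul (c 0 / s + 1)
  have hg : Tendsto (fun n : ℕ => (γ + (φ (n + 1)).coeff n / ((n : ℝ) + 1)) /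
      (1 - (φ (n + 1)).coeff 0 ^ 2)) atTop (nhds γ) := by
    have := (hl.const_add γ).div (hlim.const_sub 1) (by norm_num)
    rw [add_zero, sub_zero, div_one] at this
    exact this
  have hφ1 : (φ 1).coeff 0 ≠ 0 := by
    intro h0
    have e : φ 1 = X := by
      have := H.szego 0
      rw [zero_add, h0, H.eq_one] at this
      simpa using this
    have := H.orth 1 0 one_pos
    rw [e, ← pow_one (X : ℝ[X]), ← pow_mul, toeplitzForm_X_pow] at this
    exact hc1 (by simpa using this)
  have := exists_mul_pow_le_of_recurrence (x := fun n => n * (φ n).coeff 0) hγ hg (fun n => ?_)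
    (by simpa using hφ1) hρ
  · simpa using this
  · have hr := H.reflection_recurrence hrec n
    have h1 : 1 - (φ (n + 1)).coeff 0 ^ 2 ≠ 0 := by
      have := H.coeff_zero_sq_lt_one n; linarith
    have h2 : (n : ℝ) + 1 ≠ 0 := by positivity
    push_cast
    field_simp
    linear_combination hr

/-- The zeros of the orthogonal polynomials become equidistributed on the unit circle. -/
theorem tendsto_zeros_average (H : IsToeplitzOrthogonal c φ) (hs : 0 < s)
    (hlow : ∀ (P : ℝ[X]) (j : ℕ), s * P.coeff j ^ 2 ≤ toeplitzForm c P P)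
    {γ : ℝ} (hγ : |γ| < 1)
    (hrec : ∀ k : ℤ, (k + 1) * c (k + 1) + (k - 1) * c (k - 1) = 2 * γ * (k * c k))
    (hc1 : c 1 ≠ 0) (g : ℂ → ℝ) (hg : Continuous g) :
    Tendsto (fun n : ℕ => (((φ n).map Complex.ofRealHom).roots.map g).sum / (n : ℝ)) atTop
      (nhds ((1 / (2 * π)) * ∫ θ in (-π)..π, g (Complex.exp (θ * Complex.I)))) := by
  choose w hroots hprod using fun n => exists_fin_roots ((φ n).map Complex.ofRealHom)
    ((H.monic n).map _) (by rw [natDegree_map, H.natDegree n])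
  have hcoeff : ∀ n j, ‖(∏ i, (X - C (w n i))).coeff j‖ = |(φ n).coeff j| := fun n j => by
    rw [← hprod, coeff_map]; simp
  have hw : ∀ n i, ‖w n i‖ ≤ 1 := by
    intro n i
    by_contra! hcon
    refine (H.aeval_ne_zero_and_norm_reflect_le n hcon.le).1 ?_
    have : eval (w n i) ((φ n).map Complex.ofRealHom) = 0 := by
      rw [hprod, eval_prod]
      exact Finset.prod_eq_zero (Finset.mem_univ i) (by simp)
    rwa [eval_map] at this
  have hK : ∀ n j, |(φ n).coeff j| ≤ c 0 / s + 1 := fun n j => by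
    have := H.coeff_sq_le hs hlow n j
    rw [← sq_abs] at this
    nlinarith [abs_nonneg ((φ n).coeff j)]
  set K := c 0 / s + 1
  have hK0 : 0 ≤ K := (abs_nonneg _).trans (hK 0 0)
  have hsum : ∀ n, ((((φ n).map Complex.ofRealHom).roots.map g).sum = ∑ i, g (w n i)) := fun n => by
    rw [hroots, Multiset.map_map]; rfl
  simp_rw [hsum]
  refine tendsto_average_of_powerSums w hw ?_ ?_ g hg
  · refine tendsto_div_of_subexponential (S := fun n => ∑ i, (1 - ‖w n i‖))
      (K := (1 + (1 + K) ^ 2) * Real.exp 2)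
      (fun n => Finset.sum_nonneg fun i _ => by linarith [hw n i])
      (fun ρ hρ => H.exists_mul_pow_le hs hlow hγ hrec hc1 hρ) fun n => ?_
    set S := ∑ i, (1 - ‖w (n + 1) i‖)
    set E := ((n : ℝ) + 1) * Real.exp (1 - S) with hE
    have hE0 : 0 ≤ E := by positivity
    have h0 : |(φ (n + 1)).coeff 0| ≤ E := by
      rw [← hcoeff]
      refine (norm_coeff_zero_prod_le _).trans ?_
      rw [hE]
      have : Real.exp (-S) ≤ Real.exp (1 - S) := Real.exp_le_exp.2 (by linarith)
      nlinarith [Real.exp_pos (1 - S), (Nat.cast_nonneg n : (0 : ℝ) ≤ n)]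
    have h1 : |(φ (n + 1)).coeff 1| ≤ E := by
      rw [← hcoeff]
      have := norm_coeff_one_prod_le (w (n + 1))
      push_cast at this
      exact this
    have h2 : |n * (φ n).coeff 0| ≤ (n + 1) * ((1 + K) * E) := by
      rcases Nat.eq_zero_or_pos n with rfl | hn
      · simp; positivity
      have e : (φ n).coeff 0 = (φ (n + 1)).coeff 1 -
          (φ (n + 1)).coeff 0 * (φ n).coeff (n - 1) := by
        have := H.szego_coeff n 0 hn
        simp only [zero_add] at this
        rw [this]; ring
      have : |(φ n).coeff 0| ≤ (1 + K) * E := by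
        rw [e]
        refine (abs_sub _ _).trans ?_
        rw [abs_mul]
        have := mul_le_mul h0 (hK n (n - 1)) (abs_nonneg _) hE0
        linarith
      rw [abs_mul, Nat.abs_cast]
      gcongr
      linarith
    have h3 : |(n + 1) * (φ (n + 1)).coeff 0| ≤ (n + 1) * E := by
      rw [abs_mul, abs_of_pos (by positivity : (0 : ℝ) < n + 1)]
      gcongr
    have hexp : Real.exp (1 - S) ^ 2 = Real.exp 2 * Real.exp (-2 * S) := by
      rw [← Real.exp_nat_mul, ← Real.exp_add]; congr 1; push_cast; ring
    calc ((n + 1) * (φ (n + 1)).coeff 0) ^ 2 + (n * (φ n).coeff 0) ^ 2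
        ≤ ((n + 1) * E) ^ 2 + ((n + 1) * ((1 + K) * E)) ^ 2 := by
          gcongr ?_ + ?_
          · exact sq_le_sq' (abs_le.1 h3).1 (abs_le.1 h3).2
          · exact sq_le_sq' (abs_le.1 h2).1 (abs_le.1 h2).2
      _ = (1 + (1 + K) ^ 2) * ((n + 1 : ℝ) ^ 4 * Real.exp (1 - S) ^ 2) := by rw [hE]; ring
      _ = _ := by rw [hexp]; ring
  · intro k hk
    obtain ⟨M, hM⟩ := exists_powerSum_bound w (K := K)
      (fun n j => norm_esymm_le_of_norm_coeff_le _ (fun j => (hcoeff n j).le.trans (hK n j)) j) k hk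
    refine squeeze_zero_norm (a := fun n : ℕ => M / (n : ℝ)) (fun n => ?_)
      (tendsto_const_div_atTop_nhds_zero_nat M)
    rw [norm_div, Complex.norm_natCast]
    gcongr
    exact hM n

end IsToeplitzOrthogonal

/-- The moments of the weight `weight L s`. -/
noncomputable def weightMoment (L s : ℝ) (k : ℤ) : ℝ :=
  (if k = 0 then s else 0) + (1 - s) / (2 * π) * ∫ θ in (-L)..L, Real.cos (k * θ)

section WeightMoment

variable {L s : ℝ}

lemma weightMoment_neg (k : ℤ) : weightMoment L s (-k) = weightMoment L s k := by
  simp [weightMoment]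

lemma mul_weightMoment (k : ℤ) :
    k * weightMoment L s k = (1 - s) / π * Real.sin (k * L) := by
  rcases eq_or_ne k 0 with rfl | hk
  · simp
  have hk' : (k : ℝ) ≠ 0 := by exact_mod_cast hk
  have hI : ∫ θ in (-L)..L, Real.cos (k * θ) = 2 * Real.sin (k * L) / k := by
    rw [intervalIntegral.integral_comp_mul_left _ hk', integral_cos, mul_neg, Real.sin_neg,
      smul_eq_mul]
    field_simp
    ring
  rw [weightMoment, if_neg hk, hI]
  field_simp
  ring

lemma weightMoment_recurrence (k : ℤ) :
    (k + 1) * weightMoment L s (k + 1) + (k - 1) * weightMoment L s (k - 1) =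
      2 * Real.cos L * (k * weightMoment L s k) := by
  have h1 := mul_weightMoment (L := L) (s := s) (k + 1)
  have h2 := mul_weightMoment (L := L) (s := s) (k - 1)
  push_cast at h1 h2
  rw [h1, h2, mul_weightMoment, add_mul, sub_mul, one_mul, Real.sin_add, Real.sin_sub]
  ring

lemma weightMoment_one_ne_zero (hL : L ∈ Set.Ioo 0 π) (hs : s < 1) : weightMoment L s 1 ≠ 0 := by
  have h := mul_weightMoment (L := L) (s := s) 1
  have h1 : 0 < (1 - s) / π * Real.sin L :=
    mul_pos (div_pos (by linarith) Real.pi_pos) (Real.sin_pos_of_mem_Ioo hL)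
  simp only [Int.cast_one, one_mul] at h
  rw [h]
  exact h1.ne'

open Polynomial in
lemma toeplitzForm_weightMoment_self (P : ℝ[X]) {N : ℕ} (hN : P.natDegree < N) :
    toeplitzForm (weightMoment L s) P P = s * ∑ j ∈ Finset.range N, P.coeff j ^ 2 +
      (1 - s) / (2 * π) * ∫ θ in (-L)..L,
        ((∑ j ∈ Finset.range N, P.coeff j * Real.cos (j * θ)) ^ 2 +
          (∑ j ∈ Finset.range N, P.coeff j * Real.sin (j * θ)) ^ 2) := by
  have e0 : ∀ θ : ℝ, (∑ j ∈ Finset.range N, P.coeff j * Real.cos (j * θ)) ^ 2 +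
      (∑ j ∈ Finset.range N, P.coeff j * Real.sin (j * θ)) ^ 2 =
      ∑ i ∈ Finset.range N, ∑ j ∈ Finset.range N,
        P.coeff i * P.coeff j * Real.cos (((i : ℤ) - j : ℤ) * θ) := fun θ => by
    rw [sq, sq, Finset.sum_mul_sum, Finset.sum_mul_sum, ← Finset.sum_add_distrib]
    refine Finset.sum_congr rfl fun i _ => ?_
    rw [← Finset.sum_add_distrib]
    refine Finset.sum_congr rfl fun j _ => ?_
    push_cast
    rw [sub_mul, Real.cos_sub]
    ring
  simp_rw [e0]
  rw [intervalIntegral.integral_finsetSum fun i _ =>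
    Continuous.intervalIntegrable (by fun_prop) _ _]
  have e1 : toeplitzForm (weightMoment L s) P P = ∑ i ∈ Finset.range N, ∑ j ∈ Finset.range N,
      P.coeff i * P.coeff j * weightMoment L s ((i : ℤ) - j) := by
    rw [toeplitzForm_comm weightMoment_neg, toeplitzForm_right_eq_sum _ hN]
    refine Finset.sum_congr rfl fun i _ => ?_
    rw [toeplitzForm_comm weightMoment_neg, toeplitzForm_right_eq_sum _ hN, Finset.mul_sum]
    refine Finset.sum_congr rfl fun j _ => ?_
    rw [toeplitzForm_X_pow]
    ring
  rw [e1, Finset.mul_sum, Finset.mul_sum, ← Finset.sum_add_distrib]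
  refine Finset.sum_congr rfl fun i hi => ?_
  rw [intervalIntegral.integral_finsetSum fun i _ =>
    Continuous.intervalIntegrable (by fun_prop) _ _]
  simp only [intervalIntegral.integral_const_mul, weightMoment, mul_add, Finset.sum_add_distrib,
    sub_eq_zero, Nat.cast_inj, mul_ite, mul_zero]
  rw [Finset.sum_ite_eq, if_pos hi, Finset.mul_sum]
  congr 1
  · ring
  · exact Finset.sum_congr rfl fun j _ => by ring

open Polynomial in
lemma mul_coeff_sq_le_toeplitzForm (hL : 0 < L) (hs : s ∈ Set.Ioo (0 : ℝ) 1) (P : ℝ[X]) (j : ℕ) :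
    s * P.coeff j ^ 2 ≤ toeplitzForm (weightMoment L s) P P := by
  rw [toeplitzForm_weightMoment_self P (N := max (P.natDegree + 1) (j + 1)) (by simp)]
  have h1 : P.coeff j ^ 2 ≤ ∑ i ∈ Finset.range (max (P.natDegree + 1) (j + 1)), P.coeff i ^ 2 :=
    Finset.single_le_sum (f := fun i => P.coeff i ^ 2) (fun i _ => sq_nonneg _) (by simp)
  have h2 : 0 ≤ ∫ θ in (-L)..L,
      ((∑ i ∈ Finset.range (max (P.natDegree + 1) (j + 1)), P.coeff i * Real.cos (i * θ)) ^ 2 +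
      (∑ i ∈ Finset.range (max (P.natDegree + 1) (j + 1)), P.coeff i * Real.sin (i * θ)) ^ 2) :=
    intervalIntegral.integral_nonneg (by linarith) fun θ _ => by positivity
  have h3 : 0 ≤ (1 - s) / (2 * π) := div_nonneg (by linarith [hs.2]) (by positivity)
  have h4 := mul_nonneg h3 h2
  have h5 := mul_le_mul_of_nonneg_left h1 hs.1.le
  linarith

lemma weight_eq_one (hL : L ∈ Set.Ioo 0 π) {θ : ℝ} (hθ : θ ∈ Set.Ioo (-L) L) :
    weight L s θ = 1 := by
  refine if_pos ?_
  rw [← Real.cos_abs θ]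
  exact Real.cos_lt_cos_of_nonneg_of_le_pi (abs_nonneg _) hL.2.le (abs_lt.2 hθ)

lemma weight_eq_of_le_abs (hL : L ∈ Set.Ioo 0 π) {θ : ℝ} (h1 : L ≤ |θ|) (h2 : |θ| ≤ π) :
    weight L s θ = s := by
  refine if_neg (not_lt.2 ?_)
  rw [← Real.cos_abs θ]
  exact Real.cos_le_cos_of_nonneg_of_le_pi hL.1.le h2 h1

lemma measurable_weight : Measurable (weight L s) :=
  Measurable.ite (measurableSet_lt measurable_const Real.measurable_cos) measurable_const
    measurable_const

lemma intervalIntegrable_mul_weight (hs : s ∈ Set.Ioo (0 : ℝ) 1) {f : ℝ → ℂ} (hf : Continuous f)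
    (a b : ℝ) : IntervalIntegrable (fun θ => f θ * (weight L s θ : ℂ)) volume a b := by
  rw [intervalIntegrable_iff]
  refine (intervalIntegrable_iff.1 (hf.intervalIntegrable a b)).mul_bdd (c := 1) ?_ ?_
  · exact (Complex.measurable_ofReal.comp measurable_weight).aestronglyMeasurable
  · refine ae_of_all _ fun θ => ?_
    rw [Complex.norm_real, Real.norm_eq_abs, weight]
    split_ifs
    · simp
    · rw [abs_of_pos hs.1]; exact hs.2.le

lemma integral_exp_mul_weight (hL : L ∈ Set.Ioo 0 π) (hs : s ∈ Set.Ioo (0 : ℝ) 1) (m : ℤ) :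
    ∫ θ in (0 : ℝ)..(2 * π), Complex.exp (m * θ * Complex.I) * (weight L s θ : ℂ) =
      2 * π * weightMoment L s m := by
  have hcont : Continuous fun θ : ℝ => Complex.exp (m * θ * Complex.I) := by fun_prop
  have hper : Function.Periodic
      (fun θ : ℝ => Complex.exp (m * θ * Complex.I) * (weight L s θ : ℂ)) (2 * π) := by
    intro θ
    have h1 : Complex.exp (m * (θ + 2 * π : ℝ) * Complex.I) = Complex.exp (m * θ * Complex.I) := by
      rw [Complex.exp_eq_exp_iff_exists_int]
      exact ⟨m, by push_cast; ring⟩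
    have h2 : weight L s (θ + 2 * π) = weight L s θ := by simp [weight]
    simp only [h1, h2]
  have hshift := hper.intervalIntegral_add_eq 0 (-π)
  rw [zero_add, show -π + 2 * π = π by ring] at hshift
  rw [hshift]
  have hweightInt := intervalIntegrable_mul_weight (L := L) hs hcont
  have hexpInt := fun a b => hcont.intervalIntegrable (μ := volume) a b
  rw [← intervalIntegral.integral_add_adjacent_intervals (hweightInt (-π) (-L)) (hweightInt (-L) π),
    ← intervalIntegral.integral_add_adjacent_intervals (hweightInt (-L) L) (hweightInt L π)]
  have i1 : ∫ θ in (-π)..(-L), Complex.exp (m * θ * Complex.I) * (weight L s θ : ℂ) =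
      s * ∫ θ in (-π)..(-L), Complex.exp (m * θ * Complex.I) := by
    rw [← intervalIntegral.integral_const_mul]
    refine intervalIntegral.integral_congr fun θ hθ => ?_
    rw [Set.uIcc_of_le (by linarith [hL.2])] at hθ
    have : |θ| = -θ := abs_of_nonpos (by linarith [hθ.2, hL.1])
    rw [weight_eq_of_le_abs hL (by linarith [hθ.2]) (by linarith [hθ.1]), mul_comm]
  have i3 : ∫ θ in L..π, Complex.exp (m * θ * Complex.I) * (weight L s θ : ℂ) =
      s * ∫ θ in L..π, Complex.exp (m * θ * Complex.I) := by
    rw [← intervalIntegral.integral_const_mul]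
    refine intervalIntegral.integral_congr fun θ hθ => ?_
    rw [Set.uIcc_of_le (by linarith [hL.2])] at hθ
    have : |θ| = θ := abs_of_nonneg (by linarith [hθ.1, hL.1])
    rw [weight_eq_of_le_abs hL (by linarith [hθ.1]) (by linarith [hθ.2]), mul_comm]
  have i2 : ∫ θ in (-L)..L, Complex.exp (m * θ * Complex.I) * (weight L s θ : ℂ) =
      ∫ θ in (-L)..L, Complex.exp (m * θ * Complex.I) := by
    refine intervalIntegral.integral_congr_ae ?_
    have hne : ∀ᵐ θ : ℝ ∂volume, θ ≠ L := by simp [ae_iff, measure_singleton]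
    filter_upwards [hne] with θ hθ hmem
    rw [Set.uIoc_of_le (by linarith [hL.1])] at hmem
    rw [weight_eq_one hL ⟨hmem.1, lt_of_le_of_ne hmem.2 hθ⟩]
    simp
  have itot := integral_exp_neg_pi_pi m
  rw [← intervalIntegral.integral_add_adjacent_intervals (hexpInt (-π) (-L)) (hexpInt (-L) π),
    ← intervalIntegral.integral_add_adjacent_intervals (hexpInt (-L) L) (hexpInt L π)] at itot
  have icos : ∫ θ in (-L)..L, Complex.exp (m * θ * Complex.I) =
      ((∫ θ in (-L)..L, Real.cos (m * θ) : ℝ) : ℂ) := by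
    have hsin : ∫ θ in (-L)..L, Real.sin (m * θ) = 0 := by
      have h := intervalIntegral.integral_comp_neg (a := -L) (b := L)
        (fun θ : ℝ => Real.sin (m * θ))
      simp only [mul_neg, Real.sin_neg, intervalIntegral.integral_neg, neg_neg] at h
      linarith
    have e : ∀ θ : ℝ, Complex.exp (m * θ * Complex.I) =
        (Real.cos (m * θ) : ℂ) + (Real.sin (m * θ) : ℂ) * Complex.I := fun θ => by
      rw [Complex.exp_mul_I]; push_cast; rfl
    simp_rw [e]
    rw [intervalIntegral.integral_add (Continuous.intervalIntegrable (by fun_prop) _ _)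
      (Continuous.intervalIntegrable (by fun_prop) _ _), intervalIntegral.integral_mul_const,
      intervalIntegral.integral_ofReal, intervalIntegral.integral_ofReal, hsin]
    simp
  rw [i1, i2, i3, weightMoment]
  have hp : (π : ℂ) ≠ 0 := by exact_mod_cast Real.pi_ne_zero
  push_cast
  rw [← icos]
  have key : ∀ J : ℂ, (2 * (π : ℂ)) * ((if m = 0 then (s : ℂ) else 0) + (1 - s) / (2 * π) * J) =
      s * (if m = 0 then 2 * (π : ℂ) else 0) + (1 - s) * J := fun J => by
    split_ifs
    · field_simp
    · field_simp
      ring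
  rw [apply_ite Complex.ofReal, Complex.ofReal_zero, key, ← itot]
  ring

end WeightMoment

open Polynomial in
/-- Orthogonality with respect to the weight in terms of its moments. -/
lemma sum_coeff_mul_weightMoment {L s : ℝ} (hL : L ∈ Set.Ioo 0 π) (hs : s ∈ Set.Ioo (0 : ℝ) 1)
    (P : ℂ[X]) (k : ℕ) :
    ∫ θ in (0 : ℝ)..(2 * π), P.eval (Complex.exp (θ * Complex.I)) *
        Complex.exp (-(k : ℂ) * θ * Complex.I) * (weight L s θ : ℂ) =
      2 * π * ∑ j ∈ Finset.range (P.natDegree + 1),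
        P.coeff j * weightMoment L s ((j : ℤ) - k) := by
  have e : ∀ θ : ℝ, P.eval (Complex.exp (θ * Complex.I)) *
      Complex.exp (-(k : ℂ) * θ * Complex.I) * (weight L s θ : ℂ) =
      ∑ j ∈ Finset.range (P.natDegree + 1), P.coeff j *
        (Complex.exp (((j : ℤ) - k : ℤ) * θ * Complex.I) * (weight L s θ : ℂ)) := fun θ => by
    rw [eval_eq_sum_range, Finset.sum_mul, Finset.sum_mul]
    refine Finset.sum_congr rfl fun j _ => ?_
    rw [← Complex.exp_nat_mul, mul_assoc (P.coeff j), ← Complex.exp_add]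
    push_cast
    ring_nf
  simp_rw [e]
  rw [intervalIntegral.integral_finsetSum fun j _ =>
    (intervalIntegrable_mul_weight hs (by fun_prop) _ _).const_mul _, Finset.mul_sum]
  refine Finset.sum_congr rfl fun j _ => ?_
  rw [intervalIntegral.integral_const_mul, integral_exp_mul_weight hL hs]
  ring

open Polynomial in
/-- The complex monic orthogonal polynomial of a real even moment sequence is real. -/
lemma exists_real_of_orthogonal {c : ℤ → ℝ} (hc : ∀ k, c (-k) = c k)
    (hpos : ∀ P : ℝ[X], P ≠ 0 → 0 < toeplitzForm c P P) {Φ : ℂ[X]} {n : ℕ} (hΦ : Φ.Monic)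
    (hn : Φ.natDegree = n)
    (horth : ∀ k < n, ∑ j ∈ Finset.range (n + 1), Φ.coeff j * (c ((j : ℤ) - k) : ℂ) = 0) :
    ∃ p : ℝ[X], p.Monic ∧ p.natDegree = n ∧ p.map Complex.ofRealHom = Φ ∧
      ∀ k < n, toeplitzForm c p (X ^ k) = 0 := by
  have form_eq : ∀ {P : ℝ[X]}, P.natDegree < n + 1 → ∀ k : ℕ, toeplitzForm c P (X ^ k) =
      ∑ j ∈ Finset.range (n + 1), P.coeff j * c ((j : ℤ) - k) := fun {P} hP k => by
    rw [toeplitzForm_comm hc, toeplitzForm_right_eq_sum _ hP]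
    refine Finset.sum_congr rfl fun j _ => ?_
    rw [toeplitzForm_comm hc, toeplitzForm_X_pow]
  have hlead : Φ.coeff n = 1 := by rw [← hn]; exact hΦ
  have hbig : ∀ j, n < j → Φ.coeff j = 0 := fun j hj => coeff_eq_zero_of_natDegree_lt (hn ▸ hj)
  have hcoeff : ∀ (a : ℕ → ℝ), (∀ j, n < j → a j = 0) → ∀ j,
      (∑ i ∈ Finset.range (n + 1), monomial i (a i)).coeff j = a j := fun a ha j => by
    simp only [finsetSum_coeff, coeff_monomial, Finset.sum_ite_eq', Finset.mem_range]
    split_ifs with h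
    · rfl
    · exact (ha j (by omega)).symm
  obtain ⟨p, hp⟩ : ∃ p : ℝ[X], ∀ j, p.coeff j = (Φ.coeff j).re :=
    ⟨_, hcoeff (fun j => (Φ.coeff j).re) fun j hj => by simp [hbig j hj]⟩
  obtain ⟨q, hq⟩ : ∃ q : ℝ[X], ∀ j, q.coeff j = (Φ.coeff j).im :=
    ⟨_, hcoeff (fun j => (Φ.coeff j).im) fun j hj => by simp [hbig j hj]⟩
  have hpn : p.natDegree ≤ n := natDegree_le_iff_coeff_eq_zero.2 fun j hj => by
    rw [hp, hbig j hj, Complex.zero_re]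
  have hqn : q.natDegree ≤ n := natDegree_le_iff_coeff_eq_zero.2 fun j hj => by
    rw [hq, hbig j hj, Complex.zero_im]
  have hporth : ∀ k < n, toeplitzForm c p (X ^ k) = 0 := fun k hk => by
    simpa [form_eq (Nat.lt_succ_of_le hpn), hp] using congrArg Complex.re (horth k hk)
  have hqorth : ∀ k < n, toeplitzForm c q (X ^ k) = 0 := fun k hk => by
    simpa [form_eq (Nat.lt_succ_of_le hqn), hq] using congrArg Complex.im (horth k hk)
  have hq0 : q = 0 := by
    by_contra hne
    refine (hpos q hne).ne' ?_
    rw [toeplitzForm_right_eq_sum q (Nat.lt_succ_of_le hqn), Finset.sum_range_succ,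
      hq n, hlead, Complex.one_im, zero_mul, add_zero]
    exact Finset.sum_eq_zero fun k hk => by rw [hqorth k (Finset.mem_range.1 hk), mul_zero]
  have hp1 : p.coeff n = 1 := by rw [hp, hlead, Complex.one_re]
  refine ⟨p, monic_of_natDegree_le_of_coeff_eq_one n hpn hp1, ?_, ?_, hporth⟩
  · exact natDegree_eq_of_le_of_coeff_ne_zero hpn (by simp [hp1])
  · ext j
    have him : (Φ.coeff j).im = 0 := by rw [← hq, hq0, coeff_zero]
    rw [coeff_map, hp]
    exact Complex.ext (by simp) (by simp [him])

theorem stmt17 (L s : ℝ) (hL : L ∈ Set.Ioo 0 π) (hs : s ∈ Set.Ioo (0:ℝ) 1)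
    (φ : ℕ → Polynomial ℂ)
    (hmonic : ∀ n, (φ n).Monic) (hdeg : ∀ n, (φ n).natDegree = n)
    (horth : ∀ n : ℕ, ∀ k < n, (1 / (2 * (π:ℂ))) * ∫ θ in (0:ℝ)..(2 * π),
        (φ n).eval (Complex.exp (θ * Complex.I)) * Complex.exp (-(k:ℂ) * θ * Complex.I) *
          (weight L s θ : ℂ) = 0) :
    ∀ g : BoundedContinuousFunction ℂ ℝ,
      Tendsto (fun n : ℕ => ((φ n).roots.map (fun z => g z)).sum / (n : ℝ)) atTop
        (nhds ((1 / (2 * π)) * ∫ θ in (-π)..π, g (Complex.exp (θ * Complex.I)))) := by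
  intro g
  have hpos : ∀ P : Polynomial ℝ, P ≠ 0 → 0 < toeplitzForm (weightMoment L s) P P := fun P hP => by
    refine lt_of_lt_of_le ?_ (mul_coeff_sq_le_toeplitzForm hL.1 hs P P.natDegree)
    have : P.coeff P.natDegree ≠ 0 := Polynomial.leadingCoeff_ne_zero.2 hP
    have := hs.1
    positivity
  have hp : (π : ℂ) ≠ 0 := by exact_mod_cast Real.pi_ne_zero
  have hsum : ∀ n, ∀ k < n, ∑ j ∈ Finset.range (n + 1),
      (φ n).coeff j * (weightMoment L s ((j : ℤ) - k) : ℂ) = 0 := fun n k hk => by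
    have := horth n k hk
    rw [sum_coeff_mul_weightMoment hL hs, hdeg] at this
    simpa [hp] using this
  choose p hpm hpd hpφ hporth using fun n =>
    exists_real_of_orthogonal weightMoment_neg hpos (hmonic n) (hdeg n) (hsum n)
  have H : IsToeplitzOrthogonal (weightMoment L s) p := ⟨weightMoment_neg, hpos, hpm, hpd, hporth⟩
  have hγ : |Real.cos L| < 1 := by
    rw [← sq_lt_one_iff_abs_lt_one]
    nlinarith [Real.sin_sq_add_cos_sq L, Real.sin_pos_of_mem_Ioo hL]
  have hmain := H.tendsto_zeros_average hs.1 (mul_coeff_sq_le_toeplitzForm hL.1 hs) hγ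
    weightMoment_recurrence (weightMoment_one_ne_zero hL hs.2) g g.continuous
  simpa only [hpφ] using hmain
end
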